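/- arXiv:1509.04790 — 2 statements merged into one kernel-verified Lean document; each statement's English description precedes it below -/
import Mathlib

section
/- Every finite-dimensional (over K) left MU_v(2)-module decomposes as a direct sum of simple MU_v(2)-modules; equivalently, the category of finite-dimensional left MU_v(2)-modules is semisimple. -/
set_option synthInstance.maxHeartbeats 1000000
set_option maxHeartbeats 1000000

namespace MirabolicSL2

noncomputable section

/-- The base field `K = ℂ(v)`. -/
abbrev K : Type := RatFunc ℂ

/-- The variable `v ∈ ℂ(v)`. -/
def vv : K := RatFunc.X

/-- The quantum integer `[m] = (v^m - v^{-m})/(v - v⁻¹)`. -/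
def qn (m : ℤ) : K := (vv ^ m - vv ^ (-m)) / (vv - vv⁻¹)

/-- The five generators `e, f, k, k⁻¹, ℓ` of mirabolic quantum `sl₂`. -/
inductive G5 : Type | e | f | k | k' | l

open FreeAlgebra in
/-- The defining relations of mirabolic quantum `sl₂`. -/
inductive Rel : FreeAlgebra K G5 → FreeAlgebra K G5 → Prop
  | kk'  : Rel (ι K G5.k * ι K G5.k') 1
  | k'k  : Rel (ι K G5.k' * ι K G5.k) 1
  | kek' : Rel (ι K G5.k * ι K G5.e * ι K G5.k') ((vv ^ 2) • ι K G5.e)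
  | kfk' : Rel (ι K G5.k * ι K G5.f * ι K G5.k') ((vv ^ (-2 : ℤ)) • ι K G5.f)
  | effe : Rel (ι K G5.e * ι K G5.f - ι K G5.f * ι K G5.e)
      (((vv - vv⁻¹)⁻¹) • (ι K G5.k - ι K G5.k'))
  | ll   : Rel (ι K G5.l * ι K G5.l) (ι K G5.l)
  | kl   : Rel (ι K G5.k * ι K G5.l) (ι K G5.l * ι K G5.k)
  | lel  : Rel (ι K G5.l * ι K G5.e * ι K G5.l) (ι K G5.l * ι K G5.e)
  | lfl  : Rel (ι K G5.l * ι K G5.f * ι K G5.l) (ι K G5.f * ι K G5.l)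
  | serreE : Rel ((vv + vv⁻¹) • (ι K G5.e * ι K G5.l * ι K G5.e))
      (vv⁻¹ • (ι K G5.e * ι K G5.e * ι K G5.l) + vv • (ι K G5.l * (ι K G5.e * ι K G5.e)))
  | serreF : Rel ((vv + vv⁻¹) • (ι K G5.f * ι K G5.l * ι K G5.f))
      (vv⁻¹ • (ι K G5.l * (ι K G5.f * ι K G5.f)) + vv • (ι K G5.f * ι K G5.f * ι K G5.l))

/-- Mirabolic quantum `sl₂`: the unital `K`-algebra presented by the generators
`e, f, k, k⁻¹, ℓ` and the relations `Rel`. -/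
abbrev MU2 : Type := RingQuot Rel

/-- The generator `e` of `MU_v(2)`. -/
def Ee : MU2 := RingQuot.mkAlgHom K Rel (FreeAlgebra.ι K G5.e)
/-- The generator `f` of `MU_v(2)`. -/
def Ff : MU2 := RingQuot.mkAlgHom K Rel (FreeAlgebra.ι K G5.f)
/-- The generator `k` of `MU_v(2)`. -/
def Kk : MU2 := RingQuot.mkAlgHom K Rel (FreeAlgebra.ι K G5.k)
/-- The generator `k⁻¹` of `MU_v(2)`. -/
def Kk' : MU2 := RingQuot.mkAlgHom K Rel (FreeAlgebra.ι K G5.k')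
/-- The generator `ℓ` of `MU_v(2)`. -/
def Ll : MU2 := RingQuot.mkAlgHom K Rel (FreeAlgebra.ι K G5.l)

/-- A subspace invariant under a representation `ρ`. -/
def IsInvariant {V : Type} [AddCommGroup V] [Module K V]
    (ρ : MU2 →ₐ[K] Module.End K V) (W : Submodule K V) : Prop :=
  ∀ (a : MU2), ∀ x ∈ W, ρ a x ∈ W

/-- An invariant subspace which is simple as a subrepresentation. -/
def IsSimpleSub {V : Type} [AddCommGroup V] [Module K V]
    (ρ : MU2 →ₐ[K] Module.End K V) (W : Submodule K V) : Prop :=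
  W ≠ ⊥ ∧ IsInvariant ρ W ∧
    ∀ W' : Submodule K V, W' ≤ W → IsInvariant ρ W' → W' = ⊥ ∨ W' = W

section QuantumSl2

open Polynomial


/-- The relations of quantum `sl₂` with parameter `q`, normalised so that `E * F - F * E = k - k'`
with `k'` the inverse of `k`. -/
structure IsQuantumSl2Triple {𝕜 A : Type*} [Field 𝕜] [Ring A] [Algebra 𝕜 A]
    (q : 𝕜) (E F k k' : A) : Prop where
  k_mul_k' : k * k' = 1
  k'_mul_k : k' * k = 1
  k_mul_E : k * E = q • (E * k)
  F_mul_k : F * k = q • (k * F)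
  E_mul_F : E * F = F * E + (k - k')

namespace IsQuantumSl2Triple

section Algebra

variable {𝕜 A : Type*} [Field 𝕜] [Ring A] [Algebra 𝕜 A] {q : 𝕜} {E F k k' : A}

theorem symm (h : IsQuantumSl2Triple q E F k k') : IsQuantumSl2Triple q F E k' k where
  k_mul_k' := h.k'_mul_k
  k'_mul_k := h.k_mul_k'
  k_mul_E := by
    have := congr(k' * $(h.F_mul_k) * k')
    rwa [mul_assoc, mul_assoc, h.k_mul_k', mul_one, mul_smul_comm, ← mul_assoc, h.k'_mul_k,
      one_mul, smul_mul_assoc] at this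
  F_mul_k := by
    have := congr(k' * $(h.k_mul_E) * k')
    rwa [← mul_assoc, h.k'_mul_k, one_mul, mul_smul_comm, smul_mul_assoc, mul_assoc, mul_assoc,
      h.k_mul_k', mul_one] at this
  E_mul_F := by rw [h.E_mul_F]; abel

theorem map {B : Type*} [Ring B] [Algebra 𝕜 B] (h : IsQuantumSl2Triple q E F k k')
    (φ : A →ₐ[𝕜] B) : IsQuantumSl2Triple q (φ E) (φ F) (φ k) (φ k') where
  k_mul_k' := by rw [← map_mul, h.k_mul_k', map_one]
  k'_mul_k := by rw [← map_mul, h.k'_mul_k, map_one]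
  k_mul_E := by rw [← map_mul, h.k_mul_E, map_smul, map_mul]
  F_mul_k := by rw [← map_mul, h.F_mul_k, map_smul, map_mul]
  E_mul_F := by rw [← map_mul, h.E_mul_F, map_add, map_mul, map_sub]

theorem k_mul_E_pow (h : IsQuantumSl2Triple q E F k k') (j : ℕ) :
    k * E ^ j = q ^ j • (E ^ j * k) := by
  induction j with
  | zero => simp
  | succ j ih =>
    rw [pow_succ, ← mul_assoc, ih, smul_mul_assoc, mul_assoc, h.k_mul_E, mul_smul_comm, smul_smul,
      ← pow_succ, mul_assoc]

theorem E_mul_F_pow (h : IsQuantumSl2Triple q E F k k') (hq : q ≠ 0) (j : ℕ) :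
    E * F ^ (j + 1) = F ^ (j + 1) * E +
      (∑ i ∈ Finset.range (j + 1), q⁻¹ ^ i) • (F ^ j * (k - q ^ j • k')) := by
  induction j with
  | zero => simp [h.E_mul_F]
  | succ j ih =>
    have hkF : k * F = q⁻¹ • (F * k) := by rw [h.F_mul_k, smul_smul, inv_mul_cancel₀ hq, one_smul]
    have h₁ : (k - q ^ j • k') * F = F * (q⁻¹ • k - q ^ (j + 1) • k') := by
      rw [sub_mul, mul_sub, hkF, smul_mul_assoc, h.symm.k_mul_E, mul_smul_comm, mul_smul_comm,
        smul_smul, pow_succ]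
    have h₂ : (1 : 𝕜) + (∑ i ∈ Finset.range (j + 1), q⁻¹ ^ i) * q⁻¹ =
        ∑ i ∈ Finset.range (j + 2), q⁻¹ ^ i := by
      rw [geom_sum_succ (n := j + 1)]; ring
    have h₃ : (1 : 𝕜) + (∑ i ∈ Finset.range (j + 1), q⁻¹ ^ i) * q ^ (j + 1) =
        (∑ i ∈ Finset.range (j + 2), q⁻¹ ^ i) * q ^ (j + 1) := by
      rw [Finset.sum_range_succ _ (j + 1), add_mul, ← mul_pow, inv_mul_cancel₀ hq, one_pow]; ring
    have h₄ : ∀ c : 𝕜, c • (F ^ j * (F * (q⁻¹ • k - q ^ (j + 1) • k'))) =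
        (c * q⁻¹) • (F ^ (j + 1) * k) - (c * q ^ (j + 1)) • (F ^ (j + 1) * k') := by
      intro c
      simp only [mul_sub, mul_smul_comm, pow_succ F, mul_assoc, smul_sub, smul_smul]
    rw [pow_succ F (j + 1), ← mul_assoc, ih, add_mul, mul_assoc, h.E_mul_F, smul_mul_assoc,
      mul_assoc, h₁, h₄, mul_sub, mul_smul_comm, smul_sub, smul_smul, ← h₃, ← h₂]
    simp only [mul_add, mul_sub, add_smul, one_smul, mul_assoc]
    abel

end Algebra

section Module

variable {𝕜 V : Type*} [Field 𝕜] [AddCommGroup V] [Module 𝕜 V]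
  {q : 𝕜} {E F k k' : Module.End 𝕜 V}

theorem isNilpotent_E [FiniteDimensional 𝕜 V] (h : IsQuantumSl2Triple q E F k k')
    (hq : Function.Injective fun n : ℕ ↦ q ^ n) : ∃ m, E ^ m = 0 := by
  by_contra! hE
  let T : Module.End 𝕜 (Module.End 𝕜 V) := LinearMap.mulLeft 𝕜 k ∘ₗ LinearMap.mulRight 𝕜 k'
  have hT (n : ℕ) : T.HasEigenvalue (q ^ n) := by
    refine Module.End.hasEigenvalue_of_hasEigenvector (x := E ^ n)
      ⟨Module.End.mem_eigenspace_iff.2 ?_, hE n⟩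
    change k * (E ^ n * k') = _
    rw [← mul_assoc, h.k_mul_E_pow, smul_mul_assoc, mul_assoc, h.k_mul_k', mul_one]
  exact Set.infinite_of_injective_forall_mem hq hT (Module.End.finite_hasEigenvalue T)

theorem k_k'_apply (h : IsQuantumSl2Triple q E F k k') (x : V) : k (k' x) = x :=
  congr($(h.k_mul_k') x)

theorem k'_k_apply (h : IsQuantumSl2Triple q E F k k') (x : V) : k' (k x) = x :=
  congr($(h.k'_mul_k) x)

theorem E_k_apply (h : IsQuantumSl2Triple q E F k k') (x : V) : k (E x) = q • E (k x) :=
  congr($(h.k_mul_E) x)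

theorem F_k_apply (h : IsQuantumSl2Triple q E F k k') (x : V) : F (k x) = q • k (F x) :=
  congr($(h.F_mul_k) x)

theorem E_F_pow_apply (h : IsQuantumSl2Triple q E F k k') (hq : q ≠ 0) (j : ℕ) (x : V) :
    E ((F ^ (j + 1)) x) = (F ^ (j + 1)) (E x) +
      (∑ i ∈ Finset.range (j + 1), q⁻¹ ^ i) • (F ^ j) (k x - q ^ j • k' x) :=
  congr($(h.E_mul_F_pow hq j) x)

theorem mem_ker_E_k (h : IsQuantumSl2Triple q E F k k') (hq : q ≠ 0) {x : V} (hx : E x = 0) :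
    E (k x) = 0 := by
  have := h.E_k_apply x
  rw [hx, map_zero] at this
  exact (smul_eq_zero.1 this.symm).resolve_left hq

theorem mem_ker_E_k' (h : IsQuantumSl2Triple q E F k k') {x : V} (hx : E x = 0) :
    E (k' x) = 0 := by
  rw [h.symm.F_k_apply, hx, map_zero, smul_zero]

theorem geom_sum_inv_ne_zero (hq : Function.Injective fun n : ℕ ↦ q ^ n) (j : ℕ) :
    ∑ i ∈ Finset.range (j + 1), q⁻¹ ^ i ≠ 0 := by
  intro h0
  have := mul_geom_sum q⁻¹ (j + 1)
  rw [h0, mul_zero, eq_comm, sub_eq_zero, inv_pow, inv_eq_one] at this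
  have := hq (a₁ := j + 1) (a₂ := 0) (by simpa using this)
  omega

/-- The polynomial `∏ i < m, (X² - qⁱ)`, which annihilates `k` on highest weight vectors. -/
noncomputable def weightPoly (q : 𝕜) (m : ℕ) : 𝕜[X] :=
  ∏ i ∈ Finset.range m, (X ^ 2 - C (q ^ i))

theorem aeval_weightPoly_succ (m : ℕ) (x : V) :
    aeval k (weightPoly q (m + 1)) x = aeval k (weightPoly q m) (k (k x) - q ^ m • x) := by
  rw [weightPoly, Finset.prod_range_succ, map_mul, Module.End.mul_apply, ← weightPoly, map_sub,
    map_pow, aeval_X, aeval_C, LinearMap.sub_apply, Module.algebraMap_end_apply, pow_two,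
    Module.End.mul_apply]

theorem aeval_weightPoly_succ' (m : ℕ) (x : V) :
    aeval k (weightPoly q (m + 1)) x =
      k (k (aeval k (weightPoly q m) x)) - q ^ m • aeval k (weightPoly q m) x := by
  rw [weightPoly, Finset.prod_range_succ, mul_comm, map_mul, Module.End.mul_apply, ← weightPoly,
    map_sub, map_pow, aeval_X, aeval_C, LinearMap.sub_apply, Module.algebraMap_end_apply, pow_two,
    Module.End.mul_apply]

theorem aeval_apply_comm (p : 𝕜[X]) (x : V) : aeval k p (k x) = k (aeval k p x) := by
  have := (commute_X p).symm.map (aeval k)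
  rw [aeval_X] at this
  exact congr($this x)

theorem aeval_weightPoly_eq_zero (h : IsQuantumSl2Triple q E F k k')
    (hq : Function.Injective fun n : ℕ ↦ q ^ n) (hq0 : q ≠ 0) (m : ℕ) {x : V} (hx : E x = 0)
    (hF : (F ^ m) x = 0) : aeval k (weightPoly q m) x = 0 := by
  induction m generalizing x with
  | zero => simpa [weightPoly] using hF
  | succ m ih =>
    have h₁ := h.E_F_pow_apply hq0 m x
    rw [hF, hx, map_zero, map_zero, zero_add, eq_comm, smul_eq_zero_iff_right
      (geom_sum_inv_ne_zero hq m)] at h₁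
    have h₂ := ih (by simp [h.mem_ker_E_k hq0 hx, h.mem_ker_E_k' hx]) h₁
    have h₃ : k (k x) - q ^ m • x = k (k x - q ^ m • k' x) := by
      rw [map_sub, map_smul, h.k_k'_apply]
    rw [aeval_weightPoly_succ, h₃, aeval_apply_comm, h₂, map_zero]

/-- A vector killed by `E * F` on which `k²` acts by `q ^ (n + 2)` generates an infinite string
under `E`, unless it vanishes. -/
theorem eq_zero_of_E_F_eq_zero [FiniteDimensional 𝕜 V] (h : IsQuantumSl2Triple q E F k k')
    (hq : Function.Injective fun n : ℕ ↦ q ^ n) (hq0 : q ≠ 0) (n : ℕ) {y : V}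
    (hy : E (F y) = 0) (hk : k (k y) = q ^ (n + 2) • y) : y = 0 := by
  have step (j : ℕ) (hj : (E ^ (j + 1)) y = 0) : (E ^ j) y = 0 := by
    have h₁ := h.symm.E_F_pow_apply hq0 j y
    have h₂ : (E ^ (j + 1)) (F y) = 0 := by rw [pow_succ, Module.End.mul_apply, hy, map_zero]
    have h₃ : k' y - q ^ j • k y = (1 - q ^ (j + n + 2)) • k' y := by
      have : k y = q ^ (n + 2) • k' y := by rw [← map_smul, ← hk, h.k'_k_apply]
      rw [this, smul_smul, ← pow_add, ← add_assoc, sub_smul, one_smul]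
    have h₄ : (1 - q ^ (j + n + 2)) ≠ 0 := by
      intro h0
      have := hq (a₁ := j + n + 2) (a₂ := 0) (by simpa using (sub_eq_zero.1 h0).symm)
      omega
    rw [hj, h₂, map_zero, zero_add, h₃, map_smul, eq_comm, smul_eq_zero_iff_right
      (geom_sum_inv_ne_zero hq j), smul_eq_zero_iff_right h₄] at h₁
    have h₅ := congr($(h.k_mul_E_pow j) (k' y))
    simp only [Module.End.mul_apply, LinearMap.smul_apply, h.k_k'_apply, h₁, map_zero] at h₅
    exact (smul_eq_zero_iff_right (pow_ne_zero j hq0)).1 h₅.symm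
  obtain ⟨m, hm⟩ := h.isNilpotent_E hq
  have (j : ℕ) (hj : (E ^ j) y = 0) : y = 0 := by
    induction j with
    | zero => simpa using hj
    | succ j ih => exact ih (step j hj)
  exact this m (by rw [hm, LinearMap.zero_apply])

theorem eq_zero_of_weight [FiniteDimensional 𝕜 V] (h : IsQuantumSl2Triple q E F k k')
    (hq : Function.Injective fun n : ℕ ↦ q ^ n) (hq0 : q ≠ 0) (n : ℕ) {y : V}
    (hy : E (F y) = 0) (hk : k (k (F y)) = q ^ n • F y) : F y = 0 := by
  obtain ⟨m, hm⟩ := h.isNilpotent_E hq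
  set p := aeval k' (weightPoly q m) with hp
  have hkF : F (k (k y) - q ^ (n + 2) • y) = 0 := by
    rw [map_sub, h.F_k_apply, h.F_k_apply, map_smul, map_smul, hk, smul_smul, smul_smul,
      ← pow_two, ← pow_add, add_comm 2, sub_self]
  have hpk (x : V) : p (k x) = k (p x) := by
    rw [← h.k_k'_apply (p (k x)), hp, ← aeval_apply_comm, h.k'_k_apply]
  have hk' : k (k (p y)) = q ^ (n + 2) • p y := by
    rw [← sub_eq_zero, ← hpk, ← hpk, ← map_smul, ← map_sub]
    exact h.symm.aeval_weightPoly_eq_zero hq hq0 m hkF (by rw [hm, LinearMap.zero_apply])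
  have hFk' (x : V) : F (k' x) = q⁻¹ • k' (F x) := by
    rw [h.symm.E_k_apply, smul_smul, inv_mul_cancel₀ hq0, one_smul]
  have hk'F : k' (k' (F y)) = (q ^ n)⁻¹ • F y := by
    have := congr(k' (k' $hk))
    rw [h.k'_k_apply, h.k'_k_apply, map_smul, map_smul] at this
    rw [eq_inv_smul_iff₀ (pow_ne_zero n hq0), ← this]
  have hF (j : ℕ) : ∃ c : 𝕜, c ≠ 0 ∧ F (aeval k' (weightPoly q j) y) = c • F y := by
    induction j with
    | zero => exact ⟨1, one_ne_zero, by simp [weightPoly]⟩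
    | succ j ih =>
      obtain ⟨c, hc, hcF⟩ := ih
      refine ⟨c * ((q ^ (n + 2))⁻¹ - q ^ j), mul_ne_zero hc fun h0 ↦ ?_, ?_⟩
      · have : q ^ (n + 2 + j) = 1 := by
          rw [pow_add, ← sub_eq_zero.1 h0, mul_inv_cancel₀ (pow_ne_zero _ hq0)]
        have := hq (a₁ := n + 2 + j) (a₂ := 0) (by simpa using this)
        omega
      · rw [aeval_weightPoly_succ', map_sub, hFk', hFk', map_smul, map_smul, hcF]
        simp only [map_smul, hk'F, smul_smul, ← sub_smul]
        congr 1
        field_simp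
        ring
  obtain ⟨c, hc, hcF⟩ := hF m
  have := h.eq_zero_of_E_F_eq_zero hq hq0 n (y := p y) (by rw [hcF, map_smul, hy, smul_zero]) hk'
  rw [this, map_zero] at hcF
  exact (smul_eq_zero_iff_right hc).1 hcF.symm

theorem disjoint_ker_range [FiniteDimensional 𝕜 V] (h : IsQuantumSl2Triple q E F k k')
    (hq : Function.Injective fun n : ℕ ↦ q ^ n) (hq0 : q ≠ 0) :
    Disjoint (LinearMap.ker E) (LinearMap.range F) := by
  have key (j : ℕ) (y : V) (hy : E (F y) = 0) (hj : aeval k (weightPoly q j) (F y) = 0) :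
      F y = 0 := by
    induction j generalizing y with
    | zero => simpa [weightPoly] using hj
    | succ j ih =>
      refine h.eq_zero_of_weight hq hq0 j hy ?_
      have hFy : k (k (F y)) - q ^ j • F y = F ((q⁻¹ * q⁻¹) • k (k y) - q ^ j • y) := by
        rw [map_sub, map_smul, map_smul, h.F_k_apply, h.F_k_apply, map_smul, smul_smul, smul_smul]
        rw [show q⁻¹ * q⁻¹ * q * q = 1 by field_simp, one_smul]
      rw [← sub_eq_zero, hFy]
      refine ih _ ?_ ?_
      · rw [← hFy, map_sub, map_smul, hy, h.mem_ker_E_k hq0 (h.mem_ker_E_k hq0 hy), smul_zero,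
          sub_zero]
      · rwa [← hFy, ← aeval_weightPoly_succ]
  obtain ⟨m, hm⟩ := h.symm.isNilpotent_E hq
  rw [Submodule.disjoint_def]
  rintro _ hx ⟨y, rfl⟩
  exact key m y hx (h.aeval_weightPoly_eq_zero hq hq0 m hx (by rw [hm, LinearMap.zero_apply]))

theorem ker_sup_range [FiniteDimensional 𝕜 V] (h : IsQuantumSl2Triple q E F k k')
    (hq : Function.Injective fun n : ℕ ↦ q ^ n) (hq0 : q ≠ 0) :
    LinearMap.ker E ⊔ LinearMap.range F = ⊤ := by
  have h₁ := Submodule.finrank_add_finrank_le_of_disjoint (h.disjoint_ker_range hq hq0)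
  have h₂ := Submodule.finrank_add_finrank_le_of_disjoint (h.symm.disjoint_ker_range hq hq0)
  have h₃ := LinearMap.finrank_range_add_finrank_ker E
  have h₄ := LinearMap.finrank_range_add_finrank_ker F
  exact Submodule.eq_top_of_disjoint _ _ (by omega) (h.disjoint_ker_range hq hq0)

theorem squarefree_weightPoly [CharZero 𝕜] (hq : Function.Injective fun n : ℕ ↦ q ^ n)
    (hq0 : q ≠ 0) (m : ℕ) : Squarefree (weightPoly q m) := by
  refine Separable.squarefree (separable_prod' (fun i _ j _ hij ↦ ?_) fun i _ ↦
    separable_X_pow_sub_C _ two_ne_zero (pow_ne_zero i hq0))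
  have hne : q ^ j - q ^ i ≠ 0 := sub_ne_zero.2 fun h0 ↦ hij (hq h0).symm
  refine ⟨C (q ^ j - q ^ i)⁻¹, -C (q ^ j - q ^ i)⁻¹, ?_⟩
  have : C (q ^ j - q ^ i)⁻¹ * (C (q ^ j) - C (q ^ i)) = (1 : 𝕜[X]) := by
    rw [← C_sub, ← C_mul, inv_mul_cancel₀ hne, C_1]
  linear_combination this

theorem coe_aeval_restrict {H : Submodule 𝕜 V} (hH : ∀ x ∈ H, k x ∈ H) (p : 𝕜[X]) (x : H) :
    (aeval (k.restrict hH) p x : V) = aeval k p x := by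
  induction p using Polynomial.induction_on' generalizing x with
  | add p r hp hr => simp [hp, hr]
  | monomial n a =>
    simp only [aeval_monomial, Module.End.mul_apply, Module.algebraMap_end_apply,
      Submodule.coe_smul]
    congr 1
    induction n with
    | zero => simp
    | succ n ih => rw [pow_succ', pow_succ', Module.End.mul_apply, Module.End.mul_apply, ← ih,
        LinearMap.coe_restrict_apply]

theorem ker_mem_invtSubmodule (h : IsQuantumSl2Triple q E F k k') (hq0 : q ≠ 0) :
    LinearMap.ker E ∈ k.invtSubmodule :=
  fun _ ↦ h.mem_ker_E_k hq0

theorem isSemisimple_restrict_ker [FiniteDimensional 𝕜 V] [CharZero 𝕜]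
    (h : IsQuantumSl2Triple q E F k k') (hq : Function.Injective fun n : ℕ ↦ q ^ n) (hq0 : q ≠ 0) :
    Module.End.IsSemisimple (k.restrict (h.ker_mem_invtSubmodule hq0)) := by
  obtain ⟨m, hm⟩ := h.symm.isNilpotent_E hq
  refine Module.End.isSemisimple_of_squarefree_aeval_eq_zero (squarefree_weightPoly hq hq0 m) ?_
  ext x
  have := coe_aeval_restrict (h.ker_mem_invtSubmodule hq0) (weightPoly q m) x
  rw [h.aeval_weightPoly_eq_zero hq hq0 m x.2 (by simp [hm])] at this
  exact this

theorem mem_invtSubmodule_k' [FiniteDimensional 𝕜 V] (h : IsQuantumSl2Triple q E F k k')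
    {H : Submodule 𝕜 V} (hH : H ∈ k.invtSubmodule) : H ∈ k'.invtSubmodule := by
  have hinj : Function.Injective k := Function.LeftInverse.injective h.k'_k_apply
  have hmap : H.map k = H := Submodule.eq_of_le_of_finrank_eq
    ((Module.End.mem_invtSubmodule_iff_map_le k).1 hH)
    (Submodule.equivMapOfInjective k hinj H).finrank_eq.symm
  intro x hx
  rw [← hmap] at hx
  obtain ⟨y, hy, rfl⟩ := hx
  rwa [Submodule.mem_comap, h.k'_k_apply]

/-- The submodule generated by a space `H` of highest weight vectors. -/
def span (F : Module.End 𝕜 V) (H : Submodule 𝕜 V) : Submodule 𝕜 V := ⨆ j : ℕ, H.map (F ^ j)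

theorem mem_span {H : Submodule 𝕜 V} {x : V} (hx : x ∈ H) (j : ℕ) : (F ^ j) x ∈ span F H :=
  Submodule.mem_iSup_of_mem j (Submodule.mem_map_of_mem hx)

theorem span_le {H S : Submodule 𝕜 V} (hS : ∀ x ∈ H, ∀ j, (F ^ j) x ∈ S) : span F H ≤ S :=
  iSup_le fun j ↦ Submodule.map_le_iff_le_comap.2 fun x hx ↦ hS x hx j

theorem span_mem_invtSubmodule_F {H : Submodule 𝕜 V} : span F H ∈ F.invtSubmodule :=
  span_le fun x hx j ↦ by
    rw [Submodule.mem_comap, ← Module.End.mul_apply, ← pow_succ']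
    exact mem_span hx _

theorem span_mem_invtSubmodule_k (h : IsQuantumSl2Triple q E F k k') (hq0 : q ≠ 0)
    {H : Submodule 𝕜 V} (hH : H ∈ k.invtSubmodule) : span F H ∈ k.invtSubmodule :=
  span_le fun x hx j ↦ by
    rw [Submodule.mem_comap]
    have : (F ^ j) (k x) = q ^ j • k ((F ^ j) x) := by
      have := congr($(h.symm.k_mul_E_pow j) (k x))
      simp only [Module.End.mul_apply, LinearMap.smul_apply, h.k'_k_apply] at this
      rw [← map_smul, ← this, h.k_k'_apply]
    rw [← Submodule.smul_mem_iff _ (pow_ne_zero j hq0), ← this]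
    have hkx : k x ∈ H := hH hx
    exact mem_span hkx j

theorem span_mem_invtSubmodule_E [FiniteDimensional 𝕜 V]
    (h : IsQuantumSl2Triple q E F k k') (hq0 : q ≠ 0)
    {H : Submodule 𝕜 V} (hH : H ∈ k.invtSubmodule) (hE : H ≤ LinearMap.ker E) :
    span F H ∈ E.invtSubmodule :=
  span_le fun x hx j ↦ by
    rw [Submodule.mem_comap]
    have hEx : E x = 0 := hE hx
    cases j with
    | zero =>
      rw [pow_zero, Module.End.one_apply, hEx]
      exact zero_mem _
    | succ j =>
      rw [h.E_F_pow_apply hq0, hEx, map_zero, zero_add]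
      have hkx : k x ∈ H := hH hx
      have hk'x : k' x ∈ H := h.mem_invtSubmodule_k' hH hx
      exact Submodule.smul_mem _ _ (mem_span (H.sub_mem hkx (H.smul_mem _ hk'x)) j)

theorem eq_bot_of_disjoint_ker [FiniteDimensional 𝕜 V] (h : IsQuantumSl2Triple q E F k k')
    (hq : Function.Injective fun n : ℕ ↦ q ^ n) {S : Submodule 𝕜 V} (hS : S ∈ E.invtSubmodule)
    (hd : Disjoint S (LinearMap.ker E)) : S = ⊥ := by
  obtain ⟨m, hm⟩ := h.isNilpotent_E hq
  have (j : ℕ) : ∀ x ∈ S, (E ^ j) x = 0 → x = 0 := by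
    induction j with
    | zero => simp
    | succ j ih =>
      intro x hx hj
      rw [pow_succ, Module.End.mul_apply] at hj
      have hEx : E x ∈ S := hS hx
      exact Submodule.disjoint_def.1 hd x hx (ih (E x) hEx hj)
  exact (Submodule.eq_bot_iff S).2 fun x hx ↦ this m x hx (by rw [hm, LinearMap.zero_apply])

theorem eq_top_of_ker_le [FiniteDimensional 𝕜 V] (h : IsQuantumSl2Triple q E F k k')
    (hq : Function.Injective fun n : ℕ ↦ q ^ n) (hq0 : q ≠ 0) {S : Submodule 𝕜 V}
    (hS : S ∈ F.invtSubmodule) (hE : LinearMap.ker E ≤ S) : S = ⊤ := by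
  obtain ⟨m, hm⟩ := h.symm.isNilpotent_E hq
  have hpow (j : ℕ) : ∀ x ∈ S, (F ^ j) x ∈ S := by
    induction j with
    | zero => simp
    | succ j ih => exact fun x hx ↦ by rw [pow_succ']; exact hS (ih x hx)
  have (j : ℕ) : ∀ x, ∃ y, x - (F ^ j) y ∈ S := by
    induction j with
    | zero => exact fun x ↦ ⟨x, by simp⟩
    | succ j ih =>
      intro x
      obtain ⟨y, hy⟩ := ih x
      obtain ⟨a, ha, _, ⟨b, rfl⟩, rfl⟩ :=
        Submodule.mem_sup.1 (h.ker_sup_range hq hq0 ▸ Submodule.mem_top (x := y))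
      refine ⟨b, ?_⟩
      have := add_mem hy (hpow j a (hE ha))
      rw [map_add] at this
      convert this using 1
      rw [pow_succ, Module.End.mul_apply]
      abel
  refine (Submodule.eq_top_iff'.2 fun x ↦ ?_)
  obtain ⟨y, hy⟩ := this m x
  simpa [hm] using hy

/-- Complete reducibility for quantum `sl₂`: an invariant subspace has an invariant complement. -/
theorem exists_isCompl [FiniteDimensional 𝕜 V] [CharZero 𝕜]
    (h : IsQuantumSl2Triple q E F k k') (hq : Function.Injective fun n : ℕ ↦ q ^ n) (hq0 : q ≠ 0)
    {W : Submodule 𝕜 V} (hWE : W ∈ E.invtSubmodule) (hWF : W ∈ F.invtSubmodule)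
    (hWk : W ∈ k.invtSubmodule) :
    ∃ W' : Submodule 𝕜 V, W' ∈ E.invtSubmodule ∧ W' ∈ F.invtSubmodule ∧ W' ∈ k.invtSubmodule ∧
      IsCompl W W' := by
  have hker := h.ker_mem_invtSubmodule hq0
  obtain ⟨H, hHE, hHk, hdisj, hsup⟩ :=
    (Module.End.isSemisimple_restrict_iff _ hker).1 (h.isSemisimple_restrict_ker hq hq0)
      (W ⊓ LinearMap.ker E) (Module.End.invtSubmodule.inf_mem hWk hker) inf_le_right
  have hE := h.span_mem_invtSubmodule_E hq0 hHk hHE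
  refine ⟨span F H, hE, span_mem_invtSubmodule_F, h.span_mem_invtSubmodule_k hq0 hHk,
    disjoint_iff.2 ?_, codisjoint_iff.2 ?_⟩
  · refine h.eq_bot_of_disjoint_ker hq (Module.End.invtSubmodule.inf_mem hWE hE) ?_
    rw [Submodule.disjoint_def]
    rintro x ⟨hxW, hxS⟩ hxE
    have hdec : span F H ≤ H ⊔ LinearMap.range F := span_le fun y hy j ↦ by
      cases j with
      | zero => exact Submodule.mem_sup_left hy
      | succ j => exact Submodule.mem_sup_right ⟨(F ^ j) y, by rw [pow_succ']; rfl⟩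
    obtain ⟨a, ha, b, hb, rfl⟩ := Submodule.mem_sup.1 (hdec hxS)
    have hb0 : b = 0 := Submodule.disjoint_def.1 (h.disjoint_ker_range hq hq0) b
      (by simpa using sub_mem hxE (hHE ha)) hb
    rw [hb0, add_zero] at hxW ⊢
    exact Submodule.disjoint_def.1 hdisj a ⟨hxW, hHE ha⟩ ha
  · refine h.eq_top_of_ker_le hq hq0
      (Module.End.invtSubmodule.sup_mem hWF span_mem_invtSubmodule_F) ?_
    rw [← hsup]
    exact sup_le_sup inf_le_left fun x hx ↦ mem_span hx 0

theorem exists_projection [FiniteDimensional 𝕜 V] [CharZero 𝕜]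
    (h : IsQuantumSl2Triple q E F k k') (hq : Function.Injective fun n : ℕ ↦ q ^ n) (hq0 : q ≠ 0)
    {W : Submodule 𝕜 V} (hWE : W ∈ E.invtSubmodule) (hWF : W ∈ F.invtSubmodule)
    (hWk : W ∈ k.invtSubmodule) :
    ∃ π : Module.End 𝕜 V, (∀ x, π x ∈ W) ∧ (∀ x ∈ W, π x = x) ∧
      Commute E π ∧ Commute F π ∧ Commute k π := by
  obtain ⟨W', hE, hF, hk, hc⟩ := h.exists_isCompl hq hq0 hWE hWF hWk
  have comm (T : Module.End 𝕜 V) (hT : W ∈ T.invtSubmodule) (hT' : W' ∈ T.invtSubmodule) :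
      Commute T (W.projection W' hc) := by
    ext x
    obtain ⟨a, ha, b, hb, rfl⟩ :=
      Submodule.mem_sup.1 (hc.sup_eq_top ▸ Submodule.mem_top (x := x))
    simp only [Module.End.mul_apply, map_add, Submodule.projection_apply_of_mem_left hc ha,
      Submodule.projection_apply_of_mem_left hc (hT ha),
      Submodule.projection_apply_of_mem_right hc hb,
      Submodule.projection_apply_of_mem_right hc (hT' hb), map_zero]
  exact ⟨_, Submodule.projection_apply_mem hc,
    fun x hx ↦ Submodule.projection_apply_of_mem_left hc hx,
    comm E hWE hE, comm F hWF hF, comm k hWk hk⟩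

end Module
end IsQuantumSl2Triple
end QuantumSl2

/-- The relations between the two off-diagonal matrix units `u`, `t` and an idempotent `l` that
contains `t * u` and is orthogonal to `u * t`. -/
structure IsMatrixUnits {A : Type*} [Ring A] (l u t : A) : Prop where
  l_mul_l : l * l = l
  l_mul_u : l * u = 0
  u_mul_l : u * l = u
  l_mul_t : l * t = t
  t_mul_l : t * l = 0
  utu : u * (t * u) = u
  tut : t * (u * t) = t

namespace IsMatrixUnits

variable {A : Type*} [Ring A] {l u t : A}

theorem u_mul_u (h : IsMatrixUnits l u t) : u * u = 0 := by
  rw [← h.u_mul_l, mul_assoc, ← mul_assoc l, h.l_mul_u, zero_mul, mul_zero]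

theorem t_mul_t (h : IsMatrixUnits l u t) : t * t = 0 := by
  rw [← h.l_mul_t, ← mul_assoc, mul_assoc l, h.t_mul_l, mul_zero, zero_mul]

theorem assoc (x : A) {a b c : A} (h : a * b = c) : a * (b * x) = c * x := by
  rw [← mul_assoc, h]

theorem assoc₃ (x : A) {a b c d : A} (h : a * (b * c) = d) : a * (b * (c * x)) = d * x := by
  rw [← mul_assoc b, ← mul_assoc, h]

/-- The average of `π` over the algebra spanned by `1`, `l` and the matrix units. -/
def average (l u t π : A) : A :=
  (l - t * u) * π * (l - t * u) + (1 - l - u * t) * π * (1 - l - u * t) +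
    t * u * π * (t * u) + u * π * t

variable (h : IsMatrixUnits l u t) (π : A)
include h

theorem commute_l_average : Commute l (average l u t π) := by
  simp only [commute_iff_eq, average, mul_sub, sub_mul, mul_add, add_mul, mul_assoc, h.l_mul_l,
    h.u_mul_l, h.t_mul_l, assoc _ h.l_mul_l, assoc _ h.l_mul_u, assoc _ h.l_mul_t,
    zero_mul, mul_zero, mul_one, one_mul]
  abel

theorem commute_u_average : Commute u (average l u t π) := by
  simp only [commute_iff_eq, average, mul_sub, sub_mul, mul_add, add_mul, mul_assoc,
    h.l_mul_u, h.u_mul_u, h.utu, assoc _ h.u_mul_l, assoc _ h.u_mul_u, assoc₃ _ h.utu,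
    zero_mul, mul_zero, mul_one, one_mul]
  abel

theorem commute_t_average : Commute t (average l u t π) := by
  simp only [commute_iff_eq, average, mul_sub, sub_mul, mul_add, add_mul, mul_assoc,
    h.l_mul_t, h.t_mul_t, h.tut, assoc _ h.t_mul_l, assoc _ h.t_mul_t, assoc₃ _ h.tut,
    zero_mul, mul_zero, mul_one, one_mul]
  abel

omit h in
theorem commute_average {x : A} (hl : Commute x l) (hu : Commute x u) (ht : Commute x t)
    (hπ : Commute x π) : Commute x (average l u t π) := by
  have h₁ : Commute x (l - t * u) := hl.sub_right (ht.mul_right hu)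
  have h₂ : Commute x (1 - l - u * t) :=
    ((Commute.one_right x).sub_right hl).sub_right (hu.mul_right ht)
  exact ((((h₁.mul_right hπ).mul_right h₁).add_right ((h₂.mul_right hπ).mul_right h₂)).add_right
    (((ht.mul_right hu).mul_right hπ).mul_right (ht.mul_right hu))).add_right
    ((hu.mul_right hπ).mul_right ht)

theorem average_one : average l u t 1 = 1 := by
  simp only [average, mul_sub, sub_mul, mul_assoc, h.l_mul_l,
    h.u_mul_l, h.t_mul_l, assoc _ h.l_mul_u, assoc _ h.l_mul_t, h.utu, h.tut,
    zero_mul, mul_zero, mul_one, one_mul]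
  abel

theorem map {B : Type*} [Ring B] (φ : A →+* B) : IsMatrixUnits (φ l) (φ u) (φ t) where
  l_mul_l := by rw [← map_mul, h.l_mul_l]
  l_mul_u := by rw [← map_mul, h.l_mul_u, map_zero]
  u_mul_l := by rw [← map_mul, h.u_mul_l]
  l_mul_t := by rw [← map_mul, h.l_mul_t]
  t_mul_l := by rw [← map_mul, h.t_mul_l, map_zero]
  utu := by rw [← map_mul, ← map_mul, h.utu]
  tut := by rw [← map_mul, ← map_mul, h.tut]

end IsMatrixUnits

namespace IsMatrixUnits

variable {𝕜 A : Type*} [Field 𝕜] [Ring A] [Algebra 𝕜 A] {c : 𝕜} {l u t x : A}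

/-- The diagonal element with eigenvalues `c` on the image of `t * u`, `c⁻¹` on the image of
`u * t`, and `1` elsewhere. -/
def twist (c : 𝕜) (u t : A) : A := 1 + (c - 1) • (t * u) + (c⁻¹ - 1) • (u * t)

theorem commute_twist (h₁ : Commute x (t * u)) (h₂ : Commute x (u * t)) :
    Commute x (twist c u t) :=
  ((Commute.one_right x).add_right (h₁.smul_right _)).add_right (h₂.smul_right _)

theorem commute_mul_of_smul {a b : A} {d : 𝕜} (hd : d ≠ 0) (ha : x * a = d • (a * x))
    (hb : x * b = d⁻¹ • (b * x)) : Commute x (a * b) := by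
  rw [commute_iff_eq, ← mul_assoc, ha, smul_mul_assoc, mul_assoc, hb, mul_smul_comm, smul_smul,
    mul_inv_cancel₀ hd, one_smul, mul_assoc]

variable (h : IsMatrixUnits l u t)
include h

theorem commute_l_twist : Commute l (twist c u t) := by
  refine commute_twist ?_ ?_
  · rw [commute_iff_eq, ← mul_assoc, h.l_mul_t, mul_assoc, h.u_mul_l]
  · rw [commute_iff_eq, ← mul_assoc, h.l_mul_u, mul_assoc, h.t_mul_l, zero_mul, mul_zero]

theorem twist_mul_u : twist c u t * u = c⁻¹ • u := by
  simp only [twist, add_mul, one_mul, smul_mul_assoc, mul_assoc, h.u_mul_u, h.utu, mul_zero]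
  module

theorem u_mul_twist : u * twist c u t = c • u := by
  simp only [twist, mul_add, mul_one, mul_smul_comm, assoc _ h.u_mul_u, h.utu, zero_mul]
  module

theorem twist_mul_t : twist c u t * t = c • t := by
  simp only [twist, add_mul, one_mul, smul_mul_assoc, mul_assoc, h.t_mul_t, h.tut, mul_zero]
  module

theorem t_mul_twist : t * twist c u t = c⁻¹ • t := by
  simp only [twist, mul_add, mul_one, mul_smul_comm, assoc _ h.t_mul_t, h.tut, zero_mul]
  module

theorem twist_mul_twist_inv (hc : c ≠ 0) : twist c u t * twist c⁻¹ u t = 1 := by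
  rw [twist.eq_def c⁻¹]
  simp only [mul_add, mul_one, mul_smul_comm, ← mul_assoc, h.twist_mul_u, h.twist_mul_t, inv_inv]
  simp only [twist, smul_mul_assoc, smul_smul, sub_mul, one_mul, inv_mul_cancel₀ hc,
    mul_inv_cancel₀ hc]
  module

theorem twist_inv_mul_twist (hc : c ≠ 0) : twist c⁻¹ u t * twist c u t = 1 := by
  simpa using h.twist_mul_twist_inv (inv_ne_zero hc)

theorem commute_twist_mul_u (hc : c ≠ 0) (hx : x * u = c ^ 2 • (u * x)) :
    Commute (twist c u t * x) u := by
  rw [commute_iff_eq, mul_assoc, hx, mul_smul_comm, ← mul_assoc, ← mul_assoc, h.twist_mul_u,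
    h.u_mul_twist, smul_mul_assoc, smul_mul_assoc, smul_smul]
  congr 1
  field_simp

theorem commute_twist_mul_t (hc : c ≠ 0) (hx : x * t = (c ^ 2)⁻¹ • (t * x)) :
    Commute (twist c u t * x) t := by
  rw [commute_iff_eq, mul_assoc, hx, mul_smul_comm, ← mul_assoc, ← mul_assoc, h.twist_mul_t,
    h.t_mul_twist, smul_mul_assoc, smul_mul_assoc, smul_smul]
  congr 1
  field_simp

end IsMatrixUnits

/-- The relations of mirabolic quantum `sl₂`. -/
structure IsMirabolicTuple {𝕜 A : Type*} [Field 𝕜] [Ring A] [Algebra 𝕜 A]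
    (v : 𝕜) (e f k k' l : A) : Prop where
  k_mul_k' : k * k' = 1
  k'_mul_k : k' * k = 1
  k_mul_e : k * e = v ^ 2 • (e * k)
  f_mul_k : f * k = v ^ 2 • (k * f)
  e_mul_f : (v - v⁻¹) • (e * f - f * e) = k - k'
  l_mul_l : l * l = l
  k_mul_l : k * l = l * k
  lel : l * (e * l) = l * e
  lfl : l * (f * l) = f * l
  serre_e : (v + v⁻¹) • (e * (l * e)) = v⁻¹ • (e * (e * l)) + v • (l * (e * e))
  serre_f : (v + v⁻¹) • (f * (l * f)) = v⁻¹ • (l * (f * f)) + v • (f * (f * l))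

namespace IsMirabolicTuple

variable {𝕜 A : Type*} [Field 𝕜] [Ring A] [Algebra 𝕜 A] {v : 𝕜} {e f k k' l : A}

open IsMatrixUnits (assoc assoc₃)

/-- The part of `e` commuting with `l`. -/
def diagE (e l : A) : A := l * e + e - e * l

/-- The part of `f` commuting with `l`. -/
def diagF (f l : A) : A := f * l + f - l * f

/-- The part of `e` mapping the image of `l` to its kernel. -/
def lower (e l : A) : A := e * l - l * e

/-- The part of `f` mapping the kernel of `l` to its image. -/
def upper (f l : A) : A := l * f - f * l

theorem diagE_add_lower : diagE e l + lower e l = e := by simp only [diagE, lower]; abel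

theorem diagF_add_upper : diagF f l + upper f l = f := by simp only [diagF, upper]; abel

variable (h : IsMirabolicTuple v e f k k' l)
include h

theorem leel : l * (e * (e * l)) = l * (e * e) := by
  rw [← assoc₃ (e * l) h.lel |>.trans (mul_assoc _ _ _), h.lel, ← mul_assoc e, ← mul_assoc,
    ← mul_assoc, mul_assoc l, h.lel, mul_assoc]

theorem lffl : l * (f * (f * l)) = f * (f * l) := by
  rw [← h.lfl, assoc₃ _ h.lfl, mul_assoc, h.lfl]

theorem l_mul_lower : l * lower e l = 0 := by
  simp only [lower, mul_sub, assoc _ h.l_mul_l, h.lel, sub_self]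

theorem lower_mul_l : lower e l * l = lower e l := by
  simp only [lower, sub_mul, mul_assoc, h.l_mul_l, h.lel]

theorem l_mul_upper : l * upper f l = upper f l := by
  simp only [upper, mul_sub, assoc _ h.l_mul_l, h.lfl]

theorem upper_mul_l : upper f l * l = 0 := by
  simp only [upper, sub_mul, mul_assoc, h.l_mul_l, h.lfl, sub_self]

theorem commute_l_diagE : l * diagE e l = diagE e l * l := by
  simp only [diagE, mul_sub, sub_mul, mul_add, add_mul, mul_assoc, h.l_mul_l, h.lel,
    assoc _ h.l_mul_l]
  abel

theorem commute_l_diagF : l * diagF f l = diagF f l * l := by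
  simp only [diagF, mul_sub, sub_mul, mul_add, add_mul, mul_assoc, h.l_mul_l, h.lfl,
    assoc _ h.l_mul_l]
  abel

theorem diagE_mul_lower (hv : v ≠ 0) : diagE e l * lower e l = v ^ 2 • (lower e l * diagE e l) := by
  have h₁ : diagE e l * lower e l = e * (e * l) - e * (l * e) := by
    simp only [diagE, lower, mul_sub, sub_mul, add_mul, mul_assoc, h.lel, h.leel,
      assoc _ h.l_mul_l, assoc₃ _ h.lel]
    abel
  have h₂ : lower e l * diagE e l = e * (l * e) - l * (e * e) := by
    simp only [diagE, lower, mul_sub, sub_mul, mul_add, mul_assoc, h.lel, h.leel,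
      assoc _ h.l_mul_l, assoc₃ _ h.lel]
    abel
  have h₃ := congr(v • $(h.serre_e))
  simp only [smul_add, smul_smul, mul_inv_cancel₀ hv, one_smul, add_smul] at h₃
  rw [h₁, h₂, smul_sub, pow_two, sub_eq_sub_iff_add_eq_add, ← h₃, add_comm]

theorem upper_mul_diagF (hv : v ≠ 0) : upper f l * diagF f l = v ^ 2 • (diagF f l * upper f l) := by
  have h₁ : upper f l * diagF f l = l * (f * f) - f * (l * f) := by
    simp only [diagF, upper, mul_sub, sub_mul, mul_add, mul_assoc, h.lfl, h.lffl,
      assoc _ h.l_mul_l, assoc₃ _ h.lfl]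
    abel
  have h₂ : diagF f l * upper f l = f * (l * f) - f * (f * l) := by
    simp only [diagF, upper, mul_sub, sub_mul, add_mul, mul_assoc, h.lfl, h.lffl,
      assoc _ h.l_mul_l, assoc₃ _ h.lfl]
    abel
  have h₃ := congr(v • $(h.serre_f))
  simp only [smul_add, smul_smul, mul_inv_cancel₀ hv, one_smul, add_smul] at h₃
  rw [h₁, h₂, smul_sub, pow_two, sub_eq_sub_iff_add_eq_add, ← h₃, add_comm]

theorem k'_mul_l : k' * l = l * k' := by
  have := congr(k' * $(h.k_mul_l) * k')
  rw [← mul_assoc, h.k'_mul_k, one_mul, mul_assoc, mul_assoc, h.k_mul_k', mul_one] at this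
  exact this.symm

theorem l_mul_bracket (hv : v - v⁻¹ ≠ 0) : l * (e * f - f * e) = (e * f - f * e) * l := by
  have h₁ : l * (k - k') = (k - k') * l := by rw [mul_sub, sub_mul, h.k_mul_l, h.k'_mul_l]
  rw [← h.e_mul_f, mul_smul_comm, smul_mul_assoc] at h₁
  exact smul_right_injective A hv h₁

theorem diagE_mul_upper (hv : v - v⁻¹ ≠ 0) : diagE e l * upper f l = upper f l * diagE e l := by
  have h₁ := h.l_mul_bracket hv
  have h₂ : diagE e l * upper f l - upper f l * diagE e l =
      l * (e * f - f * e) - l * ((e * f - f * e) * l) := by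
    simp only [diagE, upper, mul_sub, sub_mul, mul_add, add_mul, mul_assoc, h.lel, h.lfl,
      assoc _ h.l_mul_l, assoc₃ _ h.lel, assoc₃ _ h.lfl]
    abel
  rw [← sub_eq_zero, h₂, ← h₁, assoc _ h.l_mul_l, sub_self]

theorem diagF_mul_lower (hv : v - v⁻¹ ≠ 0) : diagF f l * lower e l = lower e l * diagF f l := by
  have h₁ := h.l_mul_bracket hv
  have h₂ : diagF f l * lower e l - lower e l * diagF f l =
      l * ((e * f - f * e) * l) - (e * f - f * e) * l := by
    simp only [diagF, lower, mul_sub, sub_mul, mul_add, add_mul, mul_assoc, h.lel, h.lfl,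
      assoc _ h.l_mul_l, assoc₃ _ h.lel, assoc₃ _ h.lfl]
    abel
  rw [← sub_eq_zero, h₂, ← h₁, assoc _ h.l_mul_l, sub_self]

theorem bracket_diag (hv : v - v⁻¹ ≠ 0) : diagE e l * diagF f l - diagF f l * diagE e l =
    (e * f - f * e) + (upper f l * lower e l - lower e l * upper f l) := by
  have h₁ : e * f = (diagE e l + lower e l) * (diagF f l + upper f l) := by
    rw [diagE_add_lower, diagF_add_upper]
  have h₂ : f * e = (diagF f l + upper f l) * (diagE e l + lower e l) := by
    rw [diagE_add_lower, diagF_add_upper]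
  simp only [h₁, h₂, mul_add, add_mul, h.diagF_mul_lower hv, h.diagE_mul_upper hv]
  abel

theorem k'_mul_eq {a : A} {c : 𝕜} (hab : k * a = c • (a * k)) : a * k' = c • (k' * a) := by
  have := congr(k' * $hab * k')
  rwa [← mul_assoc, h.k'_mul_k, one_mul, mul_smul_comm, smul_mul_assoc, mul_assoc, mul_assoc,
    h.k_mul_k', mul_one] at this

theorem k_mul_lower : k * lower e l = v ^ 2 • (lower e l * k) := by
  simp only [lower, mul_sub, sub_mul, ← mul_assoc, h.k_mul_e, h.k_mul_l, smul_mul_assoc]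
  simp only [mul_assoc, h.k_mul_e, h.k_mul_l, mul_smul_comm, smul_sub]

theorem k_mul_diagE : k * diagE e l = v ^ 2 • (diagE e l * k) := by
  simp only [diagE, mul_add, add_mul, mul_sub, sub_mul, ← mul_assoc, h.k_mul_e, h.k_mul_l,
    smul_mul_assoc]
  simp only [mul_assoc, h.k_mul_e, h.k_mul_l, mul_smul_comm, smul_sub, smul_add]

theorem upper_mul_k : upper f l * k = v ^ 2 • (k * upper f l) := by
  simp only [upper, mul_sub, sub_mul, mul_assoc, h.f_mul_k, ← h.k_mul_l, mul_smul_comm]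
  simp only [← mul_assoc, h.f_mul_k, ← h.k_mul_l, smul_mul_assoc, smul_sub]

theorem diagF_mul_k : diagF f l * k = v ^ 2 • (k * diagF f l) := by
  simp only [diagF, mul_sub, sub_mul, mul_add, add_mul, mul_assoc, h.f_mul_k, ← h.k_mul_l,
    mul_smul_comm]
  simp only [← mul_assoc, h.f_mul_k, ← h.k_mul_l, smul_mul_assoc, smul_sub, smul_add]

theorem lower_mul_k' : lower e l * k' = v ^ 2 • (k' * lower e l) := h.k'_mul_eq h.k_mul_lower

theorem k'_mul_upper : k' * upper f l = v ^ 2 • (upper f l * k') := by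
  have := congr(k' * $(h.upper_mul_k) * k')
  rwa [← mul_assoc, mul_assoc, h.k_mul_k', mul_one, mul_smul_comm, ← mul_assoc, h.k'_mul_k, one_mul,
    smul_mul_assoc] at this

theorem lower_mul_lower : lower e l * lower e l = 0 := by
  rw [← h.lower_mul_l, mul_assoc, ← mul_assoc l, h.l_mul_lower, zero_mul, mul_zero]

theorem upper_mul_upper : upper f l * upper f l = 0 := by
  rw [← h.l_mul_upper, ← mul_assoc, mul_assoc l, h.upper_mul_l, mul_zero, zero_mul]

omit h in
theorem sub_inv_ne_zero (hv : v ≠ 0) (hv4 : v ^ 4 ≠ 1) : v - v⁻¹ ≠ 0 := by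
  intro h0
  have h₁ : v ^ 2 = 1 := by
    have := congr(v * $h0)
    rw [mul_sub, mul_inv_cancel₀ hv, mul_zero] at this
    linear_combination this
  exact hv4 (by linear_combination (v ^ 2 + 1) * h₁)

theorem smul_bracket_diag (hv : v - v⁻¹ ≠ 0) :
    (v - v⁻¹) • (diagE e l * diagF f l - diagF f l * diagE e l) =
      (k - k') + (v - v⁻¹) • (upper f l * lower e l - lower e l * upper f l) := by
  rw [h.bracket_diag hv, smul_add, h.e_mul_f]

theorem lower_upper_lower (hv : v ≠ 0) (hv4 : v ^ 4 ≠ 1) :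
    v • (lower e l * (upper f l * lower e l)) = lower e l * k' := by
  have hs := sub_inv_ne_zero hv hv4
  have h₃ : v ^ 2 • (lower e l * (diagE e l * diagF f l - diagF f l * diagE e l)) =
      (diagE e l * diagF f l - diagF f l * diagE e l) * lower e l := by
    rw [mul_sub, sub_mul, smul_sub, ← mul_assoc, ← smul_mul_assoc, ← h.diagE_mul_lower hv,
      mul_assoc (diagF f l), h.diagE_mul_lower hv, mul_smul_comm, ← mul_assoc (diagF f l),
      h.diagF_mul_lower hs, smul_mul_assoc, mul_assoc, mul_assoc, mul_assoc,
      h.diagF_mul_lower hs, ← mul_assoc (diagE e l), h.diagE_mul_lower hv, smul_mul_assoc,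
      mul_assoc]
  have hX := h.smul_bracket_diag hs
  generalize diagE e l * diagF f l - diagF f l * diagE e l = X at h₃ hX
  have h₄ : v ^ 2 • (lower e l * ((v - v⁻¹) • X)) = ((v - v⁻¹) • X) * lower e l := by
    rw [mul_smul_comm, smul_mul_assoc, ← h₃, smul_comm]
  rw [hX] at h₄
  simp only [mul_add, add_mul, mul_sub, sub_mul, mul_smul_comm, smul_mul_assoc, mul_assoc,
    assoc _ h.lower_mul_lower, h.lower_mul_lower, h.k_mul_lower, zero_mul, mul_zero] at h₄
  have h₅ : k' * lower e l = (v ^ 2)⁻¹ • (lower e l * k') := by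
    rw [h.lower_mul_k', smul_smul, inv_mul_cancel₀ (pow_ne_zero 2 hv), one_smul]
  rw [h₅] at h₄
  have hne : v ^ 2 - (v ^ 2)⁻¹ ≠ 0 := by
    intro h0
    have := congr(v ^ 2 * $h0)
    rw [mul_sub, mul_inv_cancel₀ (pow_ne_zero 2 hv), mul_zero] at this
    exact hv4 (by linear_combination this)
  apply smul_right_injective A hne
  have h₆ : (v ^ 2 - (v ^ 2)⁻¹) * v = (v - v⁻¹) * v ^ 2 + (v - v⁻¹) := by field_simp; ring
  simp only [smul_smul, h₆]
  simp only [smul_sub, smul_add, smul_zero] at h₄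
  linear_combination (norm := module) h₄

theorem upper_lower_upper (hv : v ≠ 0) (hv4 : v ^ 4 ≠ 1) :
    upper f l * (lower e l * upper f l) = v • (upper f l * k') := by
  have hs := sub_inv_ne_zero hv hv4
  have h₃ : upper f l * (diagE e l * diagF f l - diagF f l * diagE e l) =
      v ^ 2 • ((diagE e l * diagF f l - diagF f l * diagE e l) * upper f l) := by
    rw [mul_sub, sub_mul, smul_sub, ← mul_assoc, ← mul_assoc, ← h.diagE_mul_upper hs, mul_assoc,
      h.upper_mul_diagF hv, smul_mul_assoc, mul_smul_comm, mul_assoc (diagF f l),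
      ← h.diagE_mul_upper hs, mul_assoc, mul_assoc]
  have hX := h.smul_bracket_diag hs
  generalize diagE e l * diagF f l - diagF f l * diagE e l = X at h₃ hX
  have h₄ : upper f l * ((v - v⁻¹) • X) = v ^ 2 • (((v - v⁻¹) • X) * upper f l) := by
    rw [mul_smul_comm, smul_mul_assoc, h₃, smul_comm]
  rw [hX] at h₄
  simp only [mul_add, add_mul, mul_sub, sub_mul, mul_smul_comm, smul_mul_assoc, mul_assoc,
    assoc _ h.upper_mul_upper, h.upper_mul_upper, h.k'_mul_upper, h.upper_mul_k, zero_mul,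
    mul_zero] at h₄
  have hne : (v - v⁻¹) * (1 + v ^ 2) ≠ 0 := by
    refine mul_ne_zero hs fun h0 ↦ hv4 ?_
    linear_combination (v ^ 2 - 1) * h0
  apply smul_right_injective A hne
  have h₆ : (v - v⁻¹) * (1 + v ^ 2) * v = v ^ 2 * v ^ 2 - 1 := by field_simp; ring
  simp only [smul_smul, h₆]
  simp only [smul_sub, smul_add, smul_smul] at h₄
  linear_combination (norm := module) -h₄

theorem k_mul_upper (hv : v ≠ 0) : k * upper f l = (v ^ 2)⁻¹ • (upper f l * k) := by
  rw [h.upper_mul_k, smul_smul, inv_mul_cancel₀ (pow_ne_zero 2 hv), one_smul]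

/-- The matrix unit inverse to `lower e l`. -/
def unit (v : 𝕜) (f k l : A) : A := v⁻¹ • (upper f l * k)

theorem unit_mul_k' : unit v f k l * k' = v⁻¹ • upper f l := by
  rw [unit, smul_mul_assoc, mul_assoc, h.k_mul_k', mul_one]

theorem smul_unit_mul_k' (hv : v ≠ 0) : v • (unit v f k l * k') = upper f l := by
  rw [h.unit_mul_k', smul_smul, mul_inv_cancel₀ hv, one_smul]

theorem isMatrixUnits (hv : v ≠ 0) (hv4 : v ^ 4 ≠ 1) :
    IsMatrixUnits l (lower e l) (unit v f k l) where
  l_mul_l := h.l_mul_l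
  l_mul_u := h.l_mul_lower
  u_mul_l := h.lower_mul_l
  l_mul_t := by rw [unit, mul_smul_comm, ← mul_assoc, h.l_mul_upper]
  t_mul_l := by
    rw [unit, smul_mul_assoc, mul_assoc, h.k_mul_l, ← mul_assoc, h.upper_mul_l, zero_mul, smul_zero]
  utu := by
    rw [unit, smul_mul_assoc, mul_smul_comm, mul_assoc, h.k_mul_lower, mul_smul_comm, mul_smul_comm,
      ← mul_assoc (upper f l), ← mul_assoc, smul_smul]
    have : v⁻¹ * v ^ 2 = v := by field_simp
    rw [this, ← smul_mul_assoc, h.lower_upper_lower hv hv4, mul_assoc, h.k'_mul_k, mul_one]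
  tut := by
    rw [unit, smul_mul_assoc, mul_smul_comm, mul_smul_comm, mul_assoc, ← mul_assoc k,
      h.k_mul_lower, smul_mul_assoc, mul_smul_comm, mul_assoc, ← mul_assoc k, h.k_mul_upper hv,
      smul_mul_assoc, mul_smul_comm, mul_smul_comm, smul_smul, mul_assoc, ← mul_assoc (lower e l),
      ← mul_assoc (upper f l), h.upper_lower_upper hv hv4, smul_mul_assoc, mul_assoc _ k',
      assoc _ h.k'_mul_k, one_mul]
    simp only [smul_smul]
    congr 1
    field_simp

theorem diagE_mul_unit (hv : v ≠ 0) (hs : v - v⁻¹ ≠ 0) :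
    diagE e l * unit v f k l = (v ^ 2)⁻¹ • (unit v f k l * diagE e l) := by
  rw [unit, mul_smul_comm, smul_mul_assoc, ← mul_assoc, h.diagE_mul_upper hs, mul_assoc _ k,
    h.k_mul_diagE, mul_smul_comm, ← mul_assoc, smul_smul, smul_smul]
  congr 1
  field_simp

theorem diagF_mul_unit (hv : v ≠ 0) : diagF f l * unit v f k l = unit v f k l * diagF f l := by
  have : diagF f l * upper f l = (v ^ 2)⁻¹ • (upper f l * diagF f l) := by
    rw [h.upper_mul_diagF hv, smul_smul, inv_mul_cancel₀ (pow_ne_zero 2 hv), one_smul]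
  rw [unit, mul_smul_comm, smul_mul_assoc, ← mul_assoc, this, smul_mul_assoc, mul_assoc,
    h.diagF_mul_k, mul_smul_comm, inv_smul_smul₀ (pow_ne_zero 2 hv), mul_assoc]

theorem k_mul_unit (hv : v ≠ 0) : k * unit v f k l = (v ^ 2)⁻¹ • (unit v f k l * k) := by
  rw [unit, mul_smul_comm, ← mul_assoc, h.k_mul_upper hv, smul_mul_assoc, smul_mul_assoc, smul_comm]

omit h in
theorem commute_twist_of_smul {c : 𝕜} {x u t : A} (hv : v ≠ 0) (hu : x * u = v ^ 2 • (u * x))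
    (ht : x * t = (v ^ 2)⁻¹ • (t * x)) : Commute x (IsMatrixUnits.twist c u t) := by
  have hv2 := pow_ne_zero 2 hv
  refine IsMatrixUnits.commute_twist
    (IsMatrixUnits.commute_mul_of_smul (inv_ne_zero hv2) ht (by rwa [inv_inv]))
    (IsMatrixUnits.commute_mul_of_smul hv2 hu ht)

theorem commute_inv {x : A} (hx : Commute k x) : Commute k' x := by
  have := congr(k' * $(hx.eq) * k')
  rw [← mul_assoc, h.k'_mul_k, one_mul, mul_assoc, mul_assoc, h.k_mul_k', mul_one] at this
  exact this.symm

open IsMatrixUnits (twist)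

theorem twist_mul_bracket_upper_lower (hv : v ≠ 0) (hv4 : v ^ 4 ≠ 1) :
    twist v (lower e l) (unit v f k l) *
        ((v - v⁻¹) • (upper f l * lower e l - lower e l * upper f l)) =
      twist v (lower e l) (unit v f k l) * k' - twist v⁻¹ (lower e l) (unit v f k l) * k' := by
  have hm := h.isMatrixUnits hv hv4
  have h₁ : k' * lower e l = (v ^ 2)⁻¹ • (lower e l * k') := by
    rw [h.lower_mul_k', smul_smul, inv_mul_cancel₀ (pow_ne_zero 2 hv), one_smul]
  have h₂ := h.smul_unit_mul_k' hv
  generalize unit v f k l = t at *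
  have h₃ : upper f l * lower e l = v⁻¹ • (t * (lower e l * k')) := by
    rw [← h₂, smul_mul_assoc, mul_assoc, h₁, mul_smul_comm, smul_smul]
    congr 1
    field_simp
  have h₄ : lower e l * upper f l = v • (lower e l * (t * k')) := by
    rw [← h₂, mul_smul_comm]
  rw [h₃, h₄, mul_smul_comm, mul_sub, mul_smul_comm, mul_smul_comm, ← mul_assoc, hm.twist_mul_t,
    ← mul_assoc (twist v _ _), hm.twist_mul_u]
  simp only [twist, add_mul, smul_mul_assoc, one_mul, inv_inv, mul_assoc, smul_smul,
    inv_mul_cancel₀ hv, mul_inv_cancel₀ hv]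
  module

theorem isQuantumSl2Triple (hv : v ≠ 0) (hv4 : v ^ 4 ≠ 1) :
    IsQuantumSl2Triple (v ^ 2) ((v - v⁻¹) • (twist v (lower e l) (unit v f k l) * diagE e l))
      (diagF f l) (twist v (lower e l) (unit v f k l) * k)
      (twist v⁻¹ (lower e l) (unit v f k l) * k') := by
  have hs := sub_inv_ne_zero hv hv4
  have hm := h.isMatrixUnits hv hv4
  have hk {c : 𝕜} : Commute k (twist c (lower e l) (unit v f k l)) :=
    commute_twist_of_smul hv h.k_mul_lower (h.k_mul_unit hv)
  have hE : Commute (diagE e l) (twist v (lower e l) (unit v f k l)) :=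
    commute_twist_of_smul hv (h.diagE_mul_lower hv) (h.diagE_mul_unit hv hs)
  have hF : Commute (diagF f l) (twist v (lower e l) (unit v f k l)) :=
    IsMatrixUnits.commute_twist
      (.mul_right (h.diagF_mul_unit hv) (h.diagF_mul_lower hs))
      (.mul_right (h.diagF_mul_lower hs) (h.diagF_mul_unit hv))
  have hb := congr(twist v (lower e l) (unit v f k l) * $(h.smul_bracket_diag hs))
  rw [mul_add, h.twist_mul_bracket_upper_lower hv hv4] at hb
  have hi := hm.twist_mul_twist_inv hv
  have hi' := hm.twist_inv_mul_twist hv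
  generalize hD₁ : twist v (lower e l) (unit v f k l) = D at *
  generalize hD : twist v⁻¹ (lower e l) (unit v f k l) = D' at *
  have hk' : Commute k D' := hD ▸ hk
  replace hk : Commute k D := by simpa only [hD₁] using hk (c := v)
  refine ⟨?_, ?_, ?_, ?_, ?_⟩
  · rw [mul_assoc, ← mul_assoc k, hk'.eq, mul_assoc, h.k_mul_k', mul_one, hi]
  · rw [mul_assoc, ← mul_assoc k', (h.commute_inv hk).eq, mul_assoc, h.k'_mul_k, mul_one, hi']
  · rw [mul_smul_comm, smul_mul_assoc, smul_comm, mul_assoc, ← mul_assoc k, hk.eq, mul_assoc D k,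
      h.k_mul_diagE, mul_assoc D, ← mul_assoc (diagE e l), hE.eq, mul_assoc D (diagE e l),
      mul_smul_comm, mul_smul_comm]
  · rw [← mul_assoc, hF.eq, mul_assoc, h.diagF_mul_k, mul_smul_comm, mul_assoc]
  · rw [smul_mul_assoc, mul_smul_comm, ← mul_assoc (diagF f l), hF.eq, ← sub_eq_iff_eq_add',
      ← smul_sub, mul_assoc, mul_assoc, ← mul_sub, ← mul_smul_comm, hb, mul_sub]
    abel

/-- The algebra generated by a mirabolic tuple is generated by a quantum `sl₂` triple together with
`l` and two matrix units commuting with the triple. -/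
theorem exists_isQuantumSl2Triple (hv : v ≠ 0) (hv4 : v ^ 4 ≠ 1) :
    ∃ E F K K' u t : A, IsQuantumSl2Triple (v ^ 2) E F K K' ∧ IsMatrixUnits l u t ∧
      (∀ x ∈ ({E, F, K} : Set A), Commute x l ∧ Commute x u ∧ Commute x t) ∧
      ({e, f, k, k', l} : Set A) ⊆ Algebra.adjoin 𝕜 {E, F, K, K', l, u, t} := by
  have hs := sub_inv_ne_zero hv hv4
  have hm := h.isMatrixUnits hv hv4
  refine ⟨_, _, _, _, _, _, h.isQuantumSl2Triple hv hv4, hm, ?_, ?_⟩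
  · have hl : Commute (twist v (lower e l) (unit v f k l)) l := hm.commute_l_twist.symm
    rintro x (rfl | rfl | rfl)
    · exact ⟨(hl.mul_left h.commute_l_diagE.symm).smul_left _,
        (hm.commute_twist_mul_u hv (h.diagE_mul_lower hv)).smul_left _,
        (hm.commute_twist_mul_t hv (h.diagE_mul_unit hv hs)).smul_left _⟩
    · exact ⟨h.commute_l_diagF.symm, h.diagF_mul_lower hs, h.diagF_mul_unit hv⟩
    · exact ⟨hl.mul_left h.k_mul_l, hm.commute_twist_mul_u hv h.k_mul_lower,
        hm.commute_twist_mul_t hv (h.k_mul_unit hv)⟩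
  · have hi := hm.twist_mul_twist_inv hv
    have hi' := hm.twist_inv_mul_twist hv
    have hf : diagF f l + v • (unit v f k l * k') = f := by
      rw [h.smul_unit_mul_k' hv, diagF_add_upper]
    generalize hS : Algebra.adjoin 𝕜 (_ : Set A) = S
    have hsub := (Algebra.subset_adjoin (R := 𝕜)).trans (SetLike.coe_subset_coe.mpr hS.le)
    simp only [Set.insert_subset_iff, Set.singleton_subset_iff, SetLike.mem_coe] at hsub ⊢
    obtain ⟨hE, hF, hK, hK', hl, hu, ht⟩ := hsub
    have hD (c : 𝕜) : twist c (lower e l) (unit v f k l) ∈ S :=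
      add_mem (add_mem (one_mem S) (S.smul_mem (mul_mem ht hu) _)) (S.smul_mem (mul_mem hu ht) _)
    have hk : k ∈ S := by
      simpa only [← mul_assoc, hi', one_mul] using mul_mem (hD v⁻¹) hK
    have hk' : k' ∈ S := by
      simpa only [← mul_assoc, hi, one_mul] using mul_mem (hD v) hK'
    have hE' : diagE e l ∈ S := by
      have := S.smul_mem (mul_mem (hD v⁻¹) hE) (v - v⁻¹)⁻¹
      rwa [mul_smul_comm, inv_smul_smul₀ hs, ← mul_assoc, hi', one_mul] at this
    refine ⟨?_, ?_, hk, hk', hl⟩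
    · rw [← diagE_add_lower (e := e) (l := l)]
      exact add_mem hE' hu
    · rw [← hf]
      exact add_mem hF (S.smul_mem (mul_mem ht hk') _)

theorem exists_projection {V : Type*} [AddCommGroup V] [Module 𝕜 V] [FiniteDimensional 𝕜 V]
    [CharZero 𝕜] (hv : v ≠ 0) (hq : Function.Injective fun n : ℕ ↦ (v ^ 2) ^ n)
    (ρ : A →ₐ[𝕜] Module.End 𝕜 V) {W : Submodule 𝕜 V} (hW : ∀ a, W ∈ (ρ a).invtSubmodule) :
    ∃ π : Module.End 𝕜 V, (∀ x, π x ∈ W) ∧ (∀ x ∈ W, π x = x) ∧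
      ∀ x ∈ ({e, f, k, k', l} : Set A), Commute (ρ x) π := by
  have hv4 : v ^ 4 ≠ 1 := fun hv4 ↦ by
    have := @hq 2 0 (by simp [← pow_mul, hv4])
    omega
  obtain ⟨E, F, K, K', u, t, h₁, h₂, h₃, h₄⟩ := h.exists_isQuantumSl2Triple hv hv4
  obtain ⟨π, hπW, hπ, hE, hF, hK⟩ :=
    (h₁.map ρ).exists_projection hq (pow_ne_zero 2 hv) (hW E) (hW F) (hW K)
  have h₅ := h₂.map (ρ : A →+* Module.End 𝕜 V)
  set π' := IsMatrixUnits.average (ρ l) (ρ u) (ρ t) π with hπ'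
  have hcomm {x : A} (hx : x ∈ ({E, F, K} : Set A)) (hxπ : Commute (ρ x) π) : Commute (ρ x) π' :=
    have h := h₃ x hx
    IsMatrixUnits.commute_average _ (h.1.map ρ) (h.2.1.map ρ) (h.2.2.map ρ) hxπ
  have hmem (a : A) {x : V} (hx : x ∈ W) : ρ a x ∈ W := hW a hx
  refine ⟨π', fun x ↦ ?_, fun x hx ↦ ?_, ?_⟩
  · simp only [hπ', IsMatrixUnits.average, LinearMap.add_apply, Module.End.mul_apply,
      LinearMap.sub_apply, Module.End.one_apply]
    have hl (y : V) : ρ l (π y) ∈ W := hmem _ (hπW y)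
    have hu (y : V) : ρ u (π y) ∈ W := hmem _ (hπW y)
    have htu (y : V) : ρ t (ρ u (π y)) ∈ W := hmem _ (hu y)
    have hut (y : V) : ρ u (ρ t (π y)) ∈ W := hmem _ (hmem _ (hπW y))
    exact add_mem (add_mem (add_mem (sub_mem (hl _) (htu _))
      (sub_mem (sub_mem (hπW _) (hl _)) (hut _))) (htu _)) (hu _)
  · have hl := hmem l hx
    have ht := hmem t hx
    have htu := hmem t (hmem u hx)
    have hut := hmem u ht
    refine Eq.trans ?_ (LinearMap.congr_fun h₅.average_one x)
    simp only [hπ', IsMatrixUnits.average, LinearMap.add_apply, Module.End.mul_apply,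
      LinearMap.sub_apply, Module.End.one_apply, AlgHom.coe_toRingHom]
    rw [hπ _ (sub_mem hl htu), hπ _ (sub_mem (sub_mem hx hl) hut), hπ _ htu, hπ _ ht]
  · have hle : Algebra.adjoin 𝕜 {E, F, K, K', l, u, t} ≤
        (Subalgebra.centralizer 𝕜 {π'}).comap ρ := by
      refine Algebra.adjoin_le ?_
      have hKπ := hcomm (by simp) hK
      have hK'π : Commute (ρ K') π' := by
        have := congr(ρ K' * $(hKπ.eq) * ρ K')
        rw [← mul_assoc, (h₁.map ρ).k'_mul_k, one_mul, mul_assoc, mul_assoc,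
          (h₁.map ρ).k_mul_k', mul_one] at this
        exact this.symm
      simp only [Set.insert_subset_iff, Set.singleton_subset_iff, SetLike.mem_coe,
        Subalgebra.mem_comap, Subalgebra.mem_centralizer_iff, Set.mem_singleton_iff, forall_eq]
      exact ⟨(hcomm (by simp) hE).eq.symm, (hcomm (by simp) hF).eq.symm, hKπ.eq.symm, hK'π.eq.symm,
        (h₅.commute_l_average π).eq.symm, (h₅.commute_u_average π).eq.symm,
        (h₅.commute_t_average π).eq.symm⟩
    intro x hx
    have := hle (h₄ hx)
    simp only [Subalgebra.mem_comap, Subalgebra.mem_centralizer_iff, Set.mem_singleton_iff,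
      forall_eq] at this
    exact this.symm

end IsMirabolicTuple



section Presentation

theorem vv_eq_algebraMap : vv = algebraMap (Polynomial ℂ) K Polynomial.X :=
  RatFunc.algebraMap_X.symm

theorem vv_ne_zero : vv ≠ 0 := RatFunc.X_ne_zero

theorem vv_sq_pow_injective : Function.Injective fun n : ℕ ↦ (vv ^ 2) ^ n := by
  intro m n hmn
  simp only [← pow_mul, vv_eq_algebraMap, ← map_pow] at hmn
  have := congr(Polynomial.natDegree $(RatFunc.algebraMap_injective ℂ hmn))
  simpa using this

theorem isMirabolicTuple : IsMirabolicTuple vv Ee Ff Kk Kk' Ll := by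
  have hv := vv_ne_zero
  have hs : vv - vv⁻¹ ≠ 0 := IsMirabolicTuple.sub_inv_ne_zero hv fun hv4 ↦ by
    have := @vv_sq_pow_injective 2 0 (by simp [← pow_mul, hv4])
    omega
  have h₁ : Kk * Kk' = 1 := by
    simpa only [map_mul, map_one, Kk, Kk'] using RingQuot.mkAlgHom_rel K Rel.kk'
  have h₂ : Kk' * Kk = 1 := by
    simpa only [map_mul, map_one, Kk, Kk'] using RingQuot.mkAlgHom_rel K Rel.k'k
  refine ⟨h₁, h₂, ?_, ?_, ?_, ?_, ?_, ?_, ?_, ?_, ?_⟩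
  · have : Kk * Ee * Kk' = vv ^ 2 • Ee := by
      simpa only [map_mul, map_smul, Kk, Ee, Kk'] using RingQuot.mkAlgHom_rel K Rel.kek'
    rw [← smul_mul_assoc, ← this, mul_assoc _ Kk', h₂, mul_one]
  · have : Kk * Ff * Kk' = vv ^ (-2 : ℤ) • Ff := by
      simpa only [map_mul, map_smul, Kk, Ff, Kk'] using RingQuot.mkAlgHom_rel K Rel.kfk'
    have h₃ : Kk * Ff = vv ^ (-2 : ℤ) • (Ff * Kk) := by
      rw [← smul_mul_assoc, ← this, mul_assoc _ Kk', h₂, mul_one]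
    rw [h₃, smul_smul, ← zpow_natCast, ← zpow_add₀ hv]
    simp
  · have : Ee * Ff - Ff * Ee = (vv - vv⁻¹)⁻¹ • (Kk - Kk') := by
      simpa only [map_mul, map_sub, map_smul, Ee, Ff, Kk, Kk'] using
        RingQuot.mkAlgHom_rel K Rel.effe
    rw [this, smul_inv_smul₀ hs]
  · simpa only [map_mul, Ll] using RingQuot.mkAlgHom_rel K Rel.ll
  · simpa only [map_mul, Kk, Ll] using RingQuot.mkAlgHom_rel K Rel.kl
  · simpa only [map_mul, mul_assoc, Ll, Ee] using RingQuot.mkAlgHom_rel K Rel.lel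
  · simpa only [map_mul, mul_assoc, Ll, Ff] using RingQuot.mkAlgHom_rel K Rel.lfl
  · simpa only [map_mul, map_add, map_smul, mul_assoc, Ee, Ll] using
      RingQuot.mkAlgHom_rel K Rel.serreE
  · simpa only [map_mul, map_add, map_smul, mul_assoc, Ff, Ll] using
      RingQuot.mkAlgHom_rel K Rel.serreF

theorem adjoin_generators : Algebra.adjoin K {Ee, Ff, Kk, Kk', Ll} = ⊤ := by
  have := congr(Subalgebra.map (RingQuot.mkAlgHom K Rel) $(FreeAlgebra.adjoin_range_ι K G5))
  rw [AlgHom.map_adjoin, Algebra.map_top, (AlgHom.range_eq_top _).mpr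
    (RingQuot.mkAlgHom_surjective K Rel)] at this
  rw [eq_top_iff, ← this]
  refine Algebra.adjoin_mono ?_
  rintro _ ⟨_, ⟨x, rfl⟩, rfl⟩
  cases x
  exacts [.inl rfl, .inr (.inl rfl), .inr (.inr (.inl rfl)), .inr (.inr (.inr (.inl rfl))),
    .inr (.inr (.inr (.inr rfl)))]

end Presentation

section Representation

variable {V : Type} [AddCommGroup V] [Module K V] (ρ : MU2 →ₐ[K] Module.End K V)

/-- Maschke-type property: an invariant subspace has an invariant complement. -/
theorem IsInvariant.exists_isCompl [FiniteDimensional K V] {ρ : MU2 →ₐ[K] Module.End K V}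
    {W : Submodule K V} (hW : IsInvariant ρ W) :
    ∃ W' : Submodule K V, IsInvariant ρ W' ∧ IsCompl W W' := by
  have : CharZero K := charZero_of_injective_algebraMap (RatFunc.algebraMap_injective ℂ)
  obtain ⟨π, hπW, hπ, hcomm⟩ :=
    isMirabolicTuple.exists_projection vv_ne_zero vv_sq_pow_injective ρ (W := W) hW
  have hall (a : MU2) : Commute (ρ a) π := by
    have hle : Algebra.adjoin K {Ee, Ff, Kk, Kk', Ll} ≤
        (Subalgebra.centralizer K {π}).comap ρ := by
      refine Algebra.adjoin_le fun x hx ↦ ?_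
      simpa only [SetLike.mem_coe, Subalgebra.mem_comap, Subalgebra.mem_centralizer_iff,
        Set.mem_singleton_iff, forall_eq] using (hcomm x hx).eq.symm
    have := hle (adjoin_generators ▸ Algebra.mem_top : a ∈ _)
    simp only [Subalgebra.mem_comap, Subalgebra.mem_centralizer_iff, Set.mem_singleton_iff,
      forall_eq] at this
    exact this.symm
  refine ⟨LinearMap.ker π, fun a x hx ↦ ?_, ?_⟩
  · have := LinearMap.congr_fun (hall a).eq x
    rw [Module.End.mul_apply, Module.End.mul_apply, LinearMap.mem_ker.mp hx, map_zero] at this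
    exact this.symm
  · exact (LinearMap.IsProj.mk hπW hπ).isCompl

/-- The vector space `V` viewed as an `MU2`-module through `ρ`. -/
abbrev moduleOf : Module MU2 V := Module.compHom V (ρ : MU2 →+* Module.End K V)

end Representation

/-- Theorem 5.12: every finite dimensional `MU_v(2)`-module is a direct sum of
simple `MU_v(2)`-modules. -/
theorem semisimplicity
    (V : Type) [AddCommGroup V] [Module K V] [FiniteDimensional K V]
    (ρ : MU2 →ₐ[K] Module.End K V) :
    ∃ (ι : Type) (c : ι → Submodule K V),
      (∀ i, IsSimpleSub ρ (c i)) ∧ iSupIndep c ∧ iSup c = ⊤ := by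
  let _ : Module MU2 V := moduleOf ρ
  have : IsScalarTower K MU2 V :=
    ⟨fun c a x ↦ LinearMap.congr_fun (map_smul ρ c a) x⟩
  have hinv (N : Submodule MU2 V) : IsInvariant ρ (N.restrictScalars K) :=
    fun a x hx ↦ N.smul_mem a hx
  have hlift (W : Submodule K V) (hW : IsInvariant ρ W) :
      ∃ N : Submodule MU2 V, N.restrictScalars K = W :=
    ⟨{ W with smul_mem' := fun a x hx ↦ hW a x hx }, rfl⟩
  have : IsSemisimpleModule MU2 V := by
    refine (isSemisimpleModule_iff _ _).mpr ⟨fun N ↦ ?_⟩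
    obtain ⟨W, hW, hc⟩ := (hinv N).exists_isCompl
    obtain ⟨N', rfl⟩ := hlift W hW
    refine ⟨N', disjoint_iff.mpr ?_, codisjoint_iff.mpr ?_⟩
    · apply Submodule.restrictScalars_injective K
      simpa using hc.inf_eq_bot
    · apply Submodule.restrictScalars_injective K
      simpa using hc.sup_eq_top
  obtain ⟨s, hind, htop, hs⟩ := IsSemisimpleModule.exists_sSupIndep_sSup_simples_eq_top MU2 V
  refine ⟨s, fun N ↦ (N : Submodule MU2 V).restrictScalars K, fun N ↦ ⟨?_, hinv _, ?_⟩, ?_, ?_⟩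
  · have := (isSimpleModule_iff_isAtom.mp (hs N N.2)).1
    simpa using this
  · intro W hWN hW
    obtain ⟨N', rfl⟩ := hlift W hW
    have := (isSimpleModule_iff_isAtom.mp (hs N N.2)).le_iff.mp (show N' ≤ N from hWN)
    exact this.imp (fun h ↦ by simp [h]) (fun h ↦ by simp [h])
  · rw [sSupIndep_iff] at hind
    intro N
    have := disjoint_iff.mp (hind N)
    rw [disjoint_iff]
    simp only [← Submodule.restrictScalars_iSup, ← Submodule.restrictScalars_inf]
    rw [this, Submodule.restrictScalars_bot]
  · rw [← Submodule.restrictScalars_iSup, ← sSup_eq_iSup', htop, Submodule.restrictScalars_top]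

end

end MirabolicSL2
end

section
/- Let M and N be finite-dimensional left MU_v(2)-modules with the same weight space dimensions, i.e. dim_K M_{λ,ε} = dim_K N_{λ,ε} for every λ ∈ K of the form ±v^a (a ∈ ℤ) and every ε ∈ {0,1}. Then M and N are isomorphic as MU_v(2)-modules. -/
set_option synthInstance.maxHeartbeats 1000000
set_option maxHeartbeats 1000000

namespace MirabolicSL2

noncomputable section

/-- The weight space `V_{λ,ε}` of a representation `ρ` of `MU_v(2)` on `V`:
the simultaneous eigenspace `{m | k·m = λ·m, ℓ·m = ε·m}`. -/
def wtSpace {V : Type} [AddCommGroup V] [Module K V]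
    (ρ : MU2 →ₐ[K] Module.End K V) (lam eps : K) : Submodule K V :=
  LinearMap.ker (ρ Kk - lam • (1 : Module.End K V)) ⊓
    LinearMap.ker (ρ Ll - eps • (1 : Module.End K V))

/-- Isomorphism of representations of `MU_v(2)`. -/
def RepIso {V W : Type} [AddCommGroup V] [Module K V] [AddCommGroup W] [Module K W]
    (ρ : MU2 →ₐ[K] Module.End K V) (τ : MU2 →ₐ[K] Module.End K W) : Prop :=
  ∃ φ : V ≃ₗ[K] W, ∀ (a : MU2) (x : V), φ (ρ a x) = τ a (φ x)

section Representations

open Module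

/-- Operators `e, f, k, k', l` on `V` satisfying the defining relations of mirabolic quantum `sl₂`
at the parameter `v`, except the two Serre-type relations. -/
structure WeakRep {F : Type*} [Field F] (v : F) (V : Type*) [AddCommGroup V] [Module F V] where
  e : V →ₗ[F] V
  f : V →ₗ[F] V
  k : V →ₗ[F] V
  k' : V →ₗ[F] V
  l : V →ₗ[F] V
  kk' : ∀ x, k (k' x) = x
  k'k : ∀ x, k' (k x) = x
  ke : ∀ x, k (e x) = v ^ 2 • e (k x)
  fk : ∀ x, f (k x) = v ^ 2 • k (f x)
  ef : ∀ x, e (f x) = f (e x) + (v - v⁻¹)⁻¹ • (k x - k' x)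
  ll : ∀ x, l (l x) = l x
  kl : ∀ x, k (l x) = l (k x)
  lel : ∀ x, l (e (l x)) = l (e x)
  lfl : ∀ x, l (f (l x)) = f (l x)

/-- The Serre-type relations of mirabolic quantum `sl₂`. -/
structure WeakRep.Serre {F : Type*} [Field F] {v : F} {V : Type*} [AddCommGroup V] [Module F V]
    (R : WeakRep v V) : Prop where
  serreE : ∀ x, (v + v⁻¹) • R.e (R.l (R.e x)) =
    v⁻¹ • R.e (R.e (R.l x)) + v • R.l (R.e (R.e x))
  serreF : ∀ x, (v + v⁻¹) • R.f (R.l (R.f x)) =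
    v⁻¹ • R.l (R.f (R.f x)) + v • R.f (R.f (R.l x))

/-- The parameter `v` is nonzero and not a root of unity, in a field where `2 ≠ 0`. -/
structure Generic {F : Type*} [Field F] (v : F) : Prop where
  ne_zero : v ≠ 0
  pow_ne_one : ∀ n : ℕ, 0 < n → v ^ n ≠ 1
  two_ne_zero : (2 : F) ≠ 0

/-- `s` is a sign in the field `F`. -/
def IsSign {F : Type*} [Field F] (s : F) : Prop := s = 1 ∨ s = -1

section Scalars

variable {F : Type*} [Field F] {v s : F}

lemma IsSign.mul_self (hs : IsSign s) : s * s = 1 := by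
  rcases hs with rfl | rfl <;> simp

lemma IsSign.ne_zero (hs : IsSign s) : s ≠ 0 := by
  rcases hs with rfl | rfl <;> simp

lemma IsSign.inv_eq (hs : IsSign s) : s⁻¹ = s := by
  rcases hs with rfl | rfl <;> norm_num

lemma Generic.sub_inv_ne_zero (hv : Generic v) {n : ℕ} (hn : 0 < n) :
    v ^ n - (v ^ n)⁻¹ ≠ 0 := by
  have h0 : v ^ n ≠ 0 := pow_ne_zero _ hv.ne_zero
  intro h
  apply hv.pow_ne_one (n + n) (by omega)
  have : v ^ n = (v ^ n)⁻¹ := sub_eq_zero.1 h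
  rw [pow_add]
  nth_rewrite 2 [this]
  exact mul_inv_cancel₀ h0

lemma Generic.quantum_ne_zero (hv : Generic v) : v - v⁻¹ ≠ 0 := by
  simpa using hv.sub_inv_ne_zero (n := 1) one_pos

lemma Generic.sq_sub_one_ne_zero (hv : Generic v) : v ^ 2 - 1 ≠ 0 :=
  sub_ne_zero.2 (hv.pow_ne_one 2 two_pos)

lemma Generic.zpow_injective (hv : Generic v) : Function.Injective (fun a : ℤ => v ^ a) := by
  have key : ∀ a b : ℤ, a < b → v ^ a ≠ v ^ b := by
    intro a b hab h
    obtain ⟨n, hn⟩ := Int.eq_ofNat_of_zero_le (sub_nonneg.2 hab.le)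
    apply hv.pow_ne_one n (by omega)
    rw [← zpow_natCast, ← hn, zpow_sub₀ hv.ne_zero, h]
    exact div_self (zpow_ne_zero _ hv.ne_zero)
  intro a b h
  rcases lt_trichotomy a b with h1 | h1 | h1
  · exact absurd h (key _ _ h1)
  · exact h1
  · exact absurd h.symm (key _ _ h1)

end Scalars

namespace WeakRep

section Basic

variable {F : Type*} [Field F] {v : F} {V : Type*} [AddCommGroup V] [Module F V]

/-- The twist of a representation by the automorphism exchanging `e` with `f`, `k` with `k'`
and `l` with `1 - l`. -/
def twist (R : WeakRep v V) : WeakRep v V where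
  e := R.f
  f := R.e
  k := R.k'
  k' := R.k
  l := LinearMap.id - R.l
  kk' := R.k'k
  k'k := R.kk'
  ke x := by
    have h := R.fk (R.k' x)
    rw [R.kk'] at h
    rw [h, map_smul, R.k'k]
  fk x := by
    have h := R.ke (R.k' x)
    rw [R.kk'] at h
    rw [← map_smul, ← h, R.k'k]
  ef x := by
    rw [R.ef x]
    module
  ll x := by simp [R.ll]
  kl x := by
    have h : R.k' (R.l x) = R.l (R.k' x) := by
      have := R.kl (R.k' x)
      rw [R.kk'] at this
      rw [← this, R.k'k]
    simp [h]
  lel x := by simp [R.lfl]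
  lfl x := by simp [R.lel]

/-- The dual representation, defined through the anti-automorphism exchanging `e` with `f`. -/
def dual (R : WeakRep v V) : WeakRep v (Dual F V) where
  e := R.f.dualMap
  f := R.e.dualMap
  k := R.k.dualMap
  k' := R.k'.dualMap
  l := R.l.dualMap
  kk' φ := by ext x; simp [R.k'k]
  k'k φ := by ext x; simp [R.kk']
  ke φ := by ext x; simp [R.fk]
  fk φ := by ext x; simp [R.ke]
  ef φ := by ext x; simp [R.ef]
  ll φ := by ext x; simp [R.ll]
  kl φ := by ext x; simp [R.kl]
  lel φ := by ext x; simp [R.lfl]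
  lfl φ := by ext x; simp [R.lel]

lemma Serre.dual {R : WeakRep v V} (hR : R.Serre) : R.dual.Serre where
  serreE φ := by
    ext x
    have := congrArg φ (hR.serreF x)
    simpa [WeakRep.dual] using this
  serreF φ := by
    ext x
    have := congrArg φ (hR.serreE x)
    simpa [WeakRep.dual] using this

/-- A submodule stable under all the operators of a representation. -/
structure Stable (R : WeakRep v V) (p : Submodule F V) : Prop where
  e : ∀ x ∈ p, R.e x ∈ p
  f : ∀ x ∈ p, R.f x ∈ p
  k : ∀ x ∈ p, R.k x ∈ p
  k' : ∀ x ∈ p, R.k' x ∈ p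
  l : ∀ x ∈ p, R.l x ∈ p

/-- The restriction of a representation to a stable submodule. -/
def restrict (R : WeakRep v V) {p : Submodule F V} (hp : R.Stable p) : WeakRep v p where
  e := R.e.restrict hp.e
  f := R.f.restrict hp.f
  k := R.k.restrict hp.k
  k' := R.k'.restrict hp.k'
  l := R.l.restrict hp.l
  kk' x := Subtype.ext (R.kk' x)
  k'k x := Subtype.ext (R.k'k x)
  ke x := Subtype.ext (R.ke x)
  fk x := Subtype.ext (R.fk x)
  ef x := Subtype.ext (R.ef x)
  ll x := Subtype.ext (R.ll x)
  kl x := Subtype.ext (R.kl x)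
  lel x := Subtype.ext (R.lel x)
  lfl x := Subtype.ext (R.lfl x)

lemma Serre.restrict {R : WeakRep v V} (hR : R.Serre) {p : Submodule F V} (hp : R.Stable p) :
    (R.restrict hp).Serre where
  serreE x := Subtype.ext (hR.serreE x)
  serreF x := Subtype.ext (hR.serreF x)

variable {W : Type*} [AddCommGroup W] [Module F W]

/-- A linear map intertwining two representations. -/
structure Intertwines (R : WeakRep v V) (S : WeakRep v W) (α : V →ₗ[F] W) : Prop where
  e : ∀ x, α (R.e x) = S.e (α x)
  f : ∀ x, α (R.f x) = S.f (α x)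
  k : ∀ x, α (R.k x) = S.k (α x)
  l : ∀ x, α (R.l x) = S.l (α x)

lemma Intertwines.k' {R : WeakRep v V} {S : WeakRep v W} {α : V →ₗ[F] W}
    (h : R.Intertwines S α) (x : V) : α (R.k' x) = S.k' (α x) := by
  have := h.k (R.k' x)
  rw [R.kk'] at this
  rw [this, S.k'k]

lemma Intertwines.of_twist {R : WeakRep v V} {S : WeakRep v W} {α : V →ₗ[F] W}
    (h : R.twist.Intertwines S.twist α) : R.Intertwines S α where
  e := h.f
  f := h.e
  k := h.k'
  l x := by simpa [twist] using h.l x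

/-- The weight space of weight `(c, ε)`. -/
def wt (R : WeakRep v V) (c ε : F) : Submodule F V :=
  LinearMap.ker (R.k - c • (1 : Module.End F V)) ⊓ LinearMap.ker (R.l - ε • (1 : Module.End F V))

lemma mem_wt {R : WeakRep v V} {c ε : F} {x : V} :
    x ∈ R.wt c ε ↔ R.k x = c • x ∧ R.l x = ε • x := by
  simp [wt, sub_eq_zero]

lemma k'_eq {R : WeakRep v V} {c : F} (hc : c ≠ 0) {x : V} (hx : R.k x = c • x) :
    R.k' x = c⁻¹ • x := by
  have h := R.k'k x
  rw [hx, map_smul] at h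
  rw [eq_inv_smul_iff₀ hc, h]

lemma kf (R : WeakRep v V) (hv : v ≠ 0) (x : V) : R.k (R.f x) = (v ^ 2)⁻¹ • R.f (R.k x) := by
  rw [eq_inv_smul_iff₀ (pow_ne_zero _ hv), R.fk]

lemma k_f_pow (R : WeakRep v V) (hv : v ≠ 0) (j : ℕ) (x : V) :
    R.k ((R.f ^ j) x) = ((v ^ j) ^ 2)⁻¹ • (R.f ^ j) (R.k x) := by
  induction j with
  | zero => simp
  | succ j ih =>
    rw [pow_succ', Module.End.mul_apply, R.kf hv, ih, map_smul, smul_smul, Module.End.mul_apply]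
    congr 1
    field_simp
    ring

lemma k'_f_pow (R : WeakRep v V) (hv : v ≠ 0) (j : ℕ) (x : V) :
    R.k' ((R.f ^ j) x) = (v ^ j) ^ 2 • (R.f ^ j) (R.k' x) := by
  have h := R.k_f_pow hv j (R.k' x)
  rw [R.kk'] at h
  rw [← map_smul]
  have h2 : R.k (((v ^ j) ^ 2) • (R.f ^ j) (R.k' x)) = (R.f ^ j) x := by
    rw [map_smul, h, smul_inv_smul₀ (pow_ne_zero _ (pow_ne_zero _ hv))]
  rw [← h2, R.k'k, map_smul]

/-- The action of `e` on `f ^ (j + 1) x` for `x` killed by `e`. -/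
lemma e_f_pow_succ (R : WeakRep v V) (hv : Generic v) {x : V} (hx : R.e x = 0) (j : ℕ) :
    R.e ((R.f ^ (j + 1)) x) = ((v - v⁻¹)⁻¹ ^ 2 * (v ^ (j + 1) - (v ^ (j + 1))⁻¹)) •
      (R.f ^ j) ((v ^ j)⁻¹ • R.k x - v ^ j • R.k' x) := by
  have h0 := hv.ne_zero
  have h1 := hv.sq_sub_one_ne_zero
  have h2 := hv.quantum_ne_zero
  induction j with
  | zero =>
    simp only [zero_add, pow_one, R.ef, hx, map_zero, pow_zero, inv_one, one_smul,
      Module.End.one_apply]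
    congr 1
    field_simp
  | succ j ih =>
    rw [pow_succ', Module.End.mul_apply, R.ef, ih, R.k_f_pow h0, R.k'_f_pow h0, map_smul,
      ← Module.End.mul_apply, ← pow_succ']
    simp only [map_sub, map_smul]
    have h3 : v ^ j ≠ 0 := pow_ne_zero _ h0
    match_scalars
    · field_simp
      ring
    · field_simp
      ring

end Basic

section HighestWeight

variable {F : Type*} [Field F] {v : F} {V : Type*} [AddCommGroup V] [Module F V]

/-- The coefficient in `e f ^ (j + 1) x = mu • f ^ j x` for `x` of highest weight `s v ^ n`. -/
def mu (v s : F) (n j : ℕ) : F :=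
  s * (v - v⁻¹)⁻¹ ^ 2 * (v ^ (j + 1) - (v ^ (j + 1))⁻¹) * (v ^ n / v ^ j - v ^ j / v ^ n)

lemma mu_ne_zero (hv : Generic v) {s : F} (hs : IsSign s) {n j : ℕ} (hj : j < n) :
    mu v s n j ≠ 0 := by
  obtain ⟨m, rfl⟩ := Nat.exists_eq_add_of_lt hj
  have h0 := hv.ne_zero
  have h1 := hv.sub_inv_ne_zero (n := m + 1) (by omega)
  have h2 := hv.sub_inv_ne_zero (n := j + 1) (by omega)
  have h3 : v ^ (j + m + 1) / v ^ j - v ^ j / v ^ (j + m + 1) = v ^ (m + 1) - (v ^ (m + 1))⁻¹ := by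
    field_simp
    ring
  rw [mu, h3]
  exact mul_ne_zero (mul_ne_zero (mul_ne_zero hs.ne_zero
    (pow_ne_zero _ (inv_ne_zero hv.quantum_ne_zero))) h2) h1

/-- No eigenvalue `± v ^ a` of `k` has `|a| > n`. -/
def Bounded (R : WeakRep v V) (n : ℕ) : Prop :=
  ∀ s : F, IsSign s → ∀ a : ℤ, (n : ℤ) < |a| → ∀ x, R.k x = (s * v ^ a) • x → x = 0

lemma Bounded.twist (hv : Generic v) {R : WeakRep v V} {n : ℕ} (h : R.Bounded n) :
    R.twist.Bounded n := by
  intro s hs a ha x hx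
  refine h s hs (-a) (by rwa [abs_neg]) x ?_
  have hc : s * v ^ a ≠ 0 := mul_ne_zero hs.ne_zero (zpow_ne_zero _ hv.ne_zero)
  have := R.twist.k'_eq hc hx
  rwa [mul_inv, hs.inv_eq, ← zpow_neg] at this

lemma e_f_pow_of_wt (R : WeakRep v V) (hv : Generic v) {s : F} (hs : IsSign s) {n : ℕ} {x : V}
    (he : R.e x = 0) (hk : R.k x = (s * v ^ n) • x) (j : ℕ) :
    R.e ((R.f ^ (j + 1)) x) = mu v s n j • (R.f ^ j) x := by
  have h0 := hv.ne_zero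
  have hc : s * v ^ n ≠ 0 := mul_ne_zero hs.ne_zero (pow_ne_zero _ h0)
  rw [R.e_f_pow_succ hv he, hk, k'_eq hc hk, mul_inv, hs.inv_eq]
  simp only [map_sub, map_smul, mu]
  match_scalars
  field_simp

lemma eq_zero_of_f_pow_eq_zero (R : WeakRep v V) (hv : Generic v) {s : F} (hs : IsSign s) {n : ℕ}
    {x : V} (he : R.e x = 0) (hk : R.k x = (s * v ^ n) • x) {j : ℕ} (hj : j ≤ n)
    (hf : (R.f ^ j) x = 0) : x = 0 := by
  induction j with
  | zero => simpa using hf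
  | succ j ih =>
    refine ih (by omega) ?_
    have := R.e_f_pow_of_wt hv hs he hk j
    rw [hf, map_zero] at this
    exact (smul_eq_zero.1 this.symm).resolve_left (mu_ne_zero hv hs hj)

lemma k_f_pow_of_wt (R : WeakRep v V) (hv : v ≠ 0) {c : F} {x : V}
    (hk : R.k x = c • x) (j : ℕ) :
    R.k ((R.f ^ j) x) = (((v ^ j) ^ 2)⁻¹ * c) • (R.f ^ j) x := by
  rw [R.k_f_pow hv, hk, map_smul, smul_smul]

namespace Bounded

variable {R : WeakRep v V} {n : ℕ} {s : F}

lemma e_eq_zero_of_k_e (h : R.Bounded n) (hs : IsSign s) {y : V}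
    (hy : R.k y = (v ^ 2 * (s * v ^ n)) • y) : y = 0 := by
  refine h s hs (n + 2 : ℕ) ?_ y ?_
  · rw [abs_of_nonneg (by positivity)]
    push_cast
    omega
  · rw [hy, zpow_natCast]
    congr 1
    ring

lemma e_eq_zero (h : R.Bounded n) (hs : IsSign s) {x : V}
    (hx : R.k x = (s * v ^ n) • x) : R.e x = 0 := by
  apply h.e_eq_zero_of_k_e hs
  rw [R.ke, hx, map_smul, smul_smul]

lemma f_pow_eq_zero (h : R.Bounded n) (hv : Generic v) (hs : IsSign s) {x : V}
    (hx : R.k x = (s * v ^ n) • x) : (R.f ^ (n + 1)) x = 0 := by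
  have h0 := hv.ne_zero
  refine h s hs (-(n + 2 : ℕ)) ?_ _ ?_
  · rw [abs_neg, abs_of_nonneg (by positivity)]
    push_cast
    omega
  · rw [R.k_f_pow_of_wt h0 hx, zpow_neg, zpow_natCast]
    congr 1
    field_simp
    ring

lemma k_eq_of_sq (h : R.Bounded n) (hv : Generic v) (hs : IsSign s) {x y : V}
    (hx : R.k x = (s * v ^ n) • x + y) (hy : R.k y = (s * v ^ n) • y) : y = 0 := by
  have h0 := hv.ne_zero
  have hc : s * v ^ n ≠ 0 := mul_ne_zero hs.ne_zero (pow_ne_zero _ h0)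
  have hey := h.e_eq_zero hs hy
  have hex : R.e x = 0 := by
    apply h.e_eq_zero_of_k_e hs
    rw [R.ke, hx, map_add, hey, add_zero, map_smul, smul_smul]
  have hk' : R.k' x = (s * v ^ n)⁻¹ • x - (s * v ^ n)⁻¹ ^ 2 • y := by
    have h1 := R.k'k x
    rw [hx, map_add, k'_eq hc hy, map_smul] at h1
    have h2 := congrArg (fun z => (s * v ^ n)⁻¹ • z) h1
    simp only [smul_add, inv_smul_smul₀ hc] at h2
    rw [← h2]
    module
  have hfx : (R.f ^ (n + 1)) x = 0 := by
    have hfy := h.f_pow_eq_zero hv hs hy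
    refine h s hs (-(n + 2 : ℕ)) ?_ _ ?_
    · rw [abs_neg, abs_of_nonneg (by positivity)]
      push_cast
      omega
    · rw [R.k_f_pow h0, hx, map_add, hfy, add_zero, map_smul, smul_smul, zpow_neg, zpow_natCast]
      congr 1
      field_simp
      ring
  have h1 := R.e_f_pow_succ hv hex n
  rw [hfx, map_zero, hx, hk', mul_inv, hs.inv_eq] at h1
  have h2 := (smul_eq_zero.1 h1.symm).resolve_left
    (mul_ne_zero (pow_ne_zero _ (inv_ne_zero hv.quantum_ne_zero))
      (hv.sub_inv_ne_zero (Nat.succ_pos n)))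
  have h3 : (v ^ n)⁻¹ • ((s * v ^ n) • x + y) -
      v ^ n • ((s * (v ^ n)⁻¹) • x - (s * (v ^ n)⁻¹) ^ 2 • y) = (2 * (v ^ n)⁻¹) • y := by
    have hss := hs.mul_self
    have h4 : (s * (v ^ n)⁻¹) ^ 2 = ((v ^ n)⁻¹) ^ 2 := by
      rw [mul_pow, sq s, hss, one_mul]
    rw [h4]
    match_scalars
    · field_simp
      ring
    · field_simp
      ring
  rw [h3, map_smul] at h2
  have h5 := (smul_eq_zero.1 h2).resolve_left
    (mul_ne_zero hv.two_ne_zero (inv_ne_zero (pow_ne_zero _ h0)))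
  exact R.eq_zero_of_f_pow_eq_zero hv hs hey hy le_rfl h5

lemma dual [FiniteDimensional F V] (h : R.Bounded n) : R.dual.Bounded n := by
  intro s hs a ha φ hφ
  have hinj : Function.Injective (R.k - (s * v ^ a) • (1 : Module.End F V)) := by
    rw [injective_iff_map_eq_zero]
    intro x hx
    exact h s hs a ha x (by simpa [sub_eq_zero] using hx)
  have hsurj := LinearMap.injective_iff_surjective.1 hinj
  ext x
  obtain ⟨y, rfl⟩ := hsurj x
  have := LinearMap.congr_fun hφ y
  simp only [WeakRep.dual, LinearMap.dualMap_apply, LinearMap.smul_apply] at this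
  simp [this]

end Bounded

/-- The projection onto the `ε`-eigenspace of `l`, for `ε ∈ {0, 1}`. -/
def proj (R : WeakRep v V) (ε : F) : V →ₗ[F] V :=
  ε • R.l + (1 - ε) • (LinearMap.id - R.l)

lemma l_proj (R : WeakRep v V) {ε : F} (hε : ε = 0 ∨ ε = 1) (x : V) :
    R.l (R.proj ε x) = ε • R.proj ε x := by
  rcases hε with rfl | rfl <;> simp [proj, R.ll]

lemma proj_l (R : WeakRep v V) {ε : F} (hε : ε = 0 ∨ ε = 1) (x : V) :
    R.proj ε (R.l x) = ε • R.proj ε x := by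
  rcases hε with rfl | rfl <;> simp [proj, R.ll]

lemma proj_eq (R : WeakRep v V) {ε : F} (hε : ε = 0 ∨ ε = 1) {x : V} (hx : R.l x = ε • x) :
    R.proj ε x = x := by
  rcases hε with rfl | rfl <;> simp [proj, hx]

lemma k_proj (R : WeakRep v V) (ε : F) (x : V) :
    R.k (R.proj ε x) = R.proj ε (R.k x) := by
  simp [proj, R.kl]

/-- A nonzero vector of extremal weight is detected by a functional of the same weight. -/
lemma Bounded.exists_dual {R : WeakRep v V} {n : ℕ} {s : F}
    (h : R.Bounded n) (hv : Generic v) (hs : IsSign s) {ε : F} (hε : ε = 0 ∨ ε = 1) {x : V}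
    (hx : x ∈ R.wt (s * v ^ n) ε) (hx0 : x ≠ 0) :
    ∃ θ : Dual F V, θ ∈ R.dual.wt (s * v ^ n) ε ∧ θ x = 1 := by
  obtain ⟨hk, hl⟩ := mem_wt.1 hx
  have hnot : x ∉ LinearMap.range (R.k - (s * v ^ n) • (1 : Module.End F V)) := by
    rintro ⟨y, hy⟩
    simp only [LinearMap.sub_apply, LinearMap.smul_apply, Module.End.one_apply] at hy
    exact hx0 (h.k_eq_of_sq hv hs (x := y) (by rw [← hy]; abel) hk)
  obtain ⟨φ, hφx, hφ⟩ := Submodule.exists_le_ker_of_notMem hnot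
  have hφk : ∀ y, φ (R.k y) = (s * v ^ n) * φ y := by
    intro y
    have : φ ((R.k - (s * v ^ n) • (1 : Module.End F V)) y) = 0 := hφ ⟨y, rfl⟩
    simpa [sub_eq_zero] using this
  refine ⟨(φ x)⁻¹ • φ ∘ₗ R.proj ε, mem_wt.2 ⟨?_, ?_⟩, ?_⟩
  · ext y
    simp only [WeakRep.dual, LinearMap.dualMap_apply, LinearMap.smul_apply, LinearMap.comp_apply,
      ← R.k_proj, hφk, smul_eq_mul]
    ring
  · ext y
    simp only [WeakRep.dual, LinearMap.dualMap_apply, LinearMap.smul_apply, LinearMap.comp_apply,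
      R.proj_l hε, map_smul, smul_eq_mul]
    ring
  · simp [R.proj_eq hε hl, hφx]

/-- A weight that does not occur in a representation does not occur in its dual. -/
lemma dual_wt_eq_bot [FiniteDimensional F V] {R : WeakRep v V} {c ε : F} (hε : ε = 0 ∨ ε = 1)
    (h : R.wt c ε = ⊥) : R.dual.wt c ε = ⊥ := by
  rw [eq_bot_iff]
  intro φ hφ
  obtain ⟨hk, hl⟩ := mem_wt.1 hφ
  have hk' : ∀ y, φ (R.k y) = c * φ y := fun y => LinearMap.congr_fun hk y
  have hl' : ∀ y, φ (R.l y) = ε * φ y := fun y => LinearMap.congr_fun hl y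
  have hproj : ∀ y, φ (R.proj ε y) = φ y := by
    intro y
    rcases hε with rfl | rfl <;> simp [proj, hl']
  set T : V →ₗ[F] V :=
    (R.k - c • LinearMap.id) ∘ₗ R.proj ε + (LinearMap.id - R.proj ε) with hT
  have hinj : Function.Injective T := by
    rw [injective_iff_map_eq_zero]
    intro x hx
    have hpp : ∀ z, R.proj ε (R.proj ε z) = R.proj ε z := fun z => R.proj_eq hε (R.l_proj hε z)
    have h1 : R.k (R.proj ε x) - c • R.proj ε x + (x - R.proj ε x) = 0 := by simpa [hT] using hx
    have h2 : R.k (R.proj ε x) - c • R.proj ε x = 0 := by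
      have := congrArg (R.proj ε) h1
      simpa only [map_add, map_sub, map_smul, ← R.k_proj, hpp, sub_self, add_zero,
        map_zero] using this
    have h3 : x = R.proj ε x := by
      rw [h2, zero_add] at h1
      exact sub_eq_zero.1 h1
    have h4 : R.proj ε x ∈ R.wt c ε := mem_wt.2 ⟨sub_eq_zero.1 h2, R.l_proj hε x⟩
    rw [h, Submodule.mem_bot] at h4
    rw [h3, h4]
  have hsurj := LinearMap.injective_iff_surjective.1 hinj
  rw [Submodule.mem_bot]
  ext x
  obtain ⟨y, rfl⟩ := hsurj x
  simp [hT, hk', hproj]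

end HighestWeight

section Strings

variable {F : Type*} [Field F] {v : F} {V : Type*} [AddCommGroup V] [Module F V]
  {W : Type*} [AddCommGroup W] [Module F W]

lemma sum_range_eq_of_telescope {g g' P : ℕ → W} {n : ℕ} (h0 : g 0 = g' 0 + P 0)
    (hs : ∀ j, j + 1 < n → g (j + 1) + P j = g' (j + 1) + P (j + 1)) (hn : P (n - 1) = 0) :
    ∑ j ∈ Finset.range n, g j = ∑ j ∈ Finset.range n, g' j := by
  have key : ∀ m, m < n →
      ∑ j ∈ Finset.range (m + 1), g j = ∑ j ∈ Finset.range (m + 1), g' j + P m := by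
    intro m hm
    induction m with
    | zero => simpa using h0
    | succ m ih =>
      rw [Finset.sum_range_succ, ih (by omega), Finset.sum_range_succ _ (m + 1), add_assoc,
        add_comm (P m), hs m hm, add_assoc]
  cases n with
  | zero => simp
  | succ m =>
    rw [key m (by omega)]
    rw [Nat.add_sub_cancel] at hn
    rw [hn, add_zero]

/-- Vectors of extremal weight with `l = 1` are exchanged by intertwiners. -/
theorem exists_intertwines_of_wt_one [FiniteDimensional F V] (hv : Generic v) {R : WeakRep v V}
    {S : WeakRep v W} {n : ℕ} {s : F} (hs : IsSign s) (hR : R.Bounded n) (hS : S.Bounded n)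
    {h : V} (hh : h ∈ R.wt (s * v ^ n) 1) (h0 : h ≠ 0) {h' : W} (hh' : h' ∈ S.wt (s * v ^ n) 1) :
    ∃ α : V →ₗ[F] W, R.Intertwines S α ∧ α h = h' := by
  obtain ⟨θ, hθ, hθh⟩ := hR.exists_dual hv hs (Or.inr rfl) hh h0
  obtain ⟨hk', hl'⟩ := mem_wt.1 hh'
  obtain ⟨hkθ, hlθ⟩ := mem_wt.1 hθ
  rw [one_smul] at hl' hlθ
  have he' := hS.e_eq_zero hs hk'
  have heθ := hR.dual.e_eq_zero hs hkθ
  have hV := hv.ne_zero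
  set ξ : ℕ → Dual F V := fun j => (R.dual.f ^ j) θ with hξ
  set x : ℕ → W := fun j => (S.f ^ j) h' with hx
  set p : ℕ → F := fun j => ∏ i ∈ Finset.range j, mu v s n i with hp
  have hξn : ξ (n + 1) = 0 := hR.dual.f_pow_eq_zero hv hs hkθ
  have hxn : x (n + 1) = 0 := hS.f_pow_eq_zero hv hs hk'
  have hξs : ∀ j z, ξ j (R.e z) = ξ (j + 1) z := by
    intro j z
    simp only [hξ, pow_succ', Module.End.mul_apply]
    rfl
  have hxs : ∀ j, S.f (x j) = x (j + 1) := by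
    intro j
    simp only [hx, pow_succ', Module.End.mul_apply]
  have hξ0 : ∀ z, ξ 0 (R.f z) = 0 := fun z => LinearMap.congr_fun heθ z
  have hx0 : S.e (x 0) = 0 := he'
  have hξf : ∀ j z, ξ (j + 1) (R.f z) = mu v s n j * ξ j z := fun j z =>
    LinearMap.congr_fun (R.dual.e_f_pow_of_wt hv hs heθ hkθ j) z
  have hxe : ∀ j, S.e (x (j + 1)) = mu v s n j • x j := S.e_f_pow_of_wt hv hs he' hk'
  have hξk : ∀ j z, ξ j (R.k z) = (((v ^ j) ^ 2)⁻¹ * (s * v ^ n)) * ξ j z := fun j z =>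
    LinearMap.congr_fun (R.dual.k_f_pow_of_wt hV hkθ j) z
  have hxk : ∀ j, S.k (x j) = (((v ^ j) ^ 2)⁻¹ * (s * v ^ n)) • x j := S.k_f_pow_of_wt hV hk'
  have hξl : ∀ j z, ξ j (R.l z) = ξ j z := fun j z => by
    have key : ∀ j, R.dual.l (ξ j) = ξ j := by
      intro j
      induction j with
      | zero => simpa [hξ] using hlθ
      | succ j ih =>
        have : ξ (j + 1) = R.dual.f (ξ j) := by
          simp only [hξ, pow_succ', Module.End.mul_apply]
        rw [this, ← ih, R.dual.lfl]
    exact LinearMap.congr_fun (key j) z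
  have hxl : ∀ j, S.l (x j) = x j := by
    intro j
    induction j with
    | zero => simpa [hx] using hl'
    | succ j ih => rw [← hxs, ← ih, S.lfl]
  have hpn : ∀ j, j < n + 1 → p j ≠ 0 := by
    intro j hj
    refine Finset.prod_ne_zero_iff.2 fun i hi => mu_ne_zero hv hs ?_
    have := Finset.mem_range.1 hi
    omega
  have hps : ∀ j, j + 1 < n + 1 → (p (j + 1))⁻¹ * mu v s n j = (p j)⁻¹ := by
    intro j hj
    have h1 := hpn (j + 1) hj
    have h2 : p (j + 1) = p j * mu v s n j := Finset.prod_range_succ _ _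
    have h3 := mu_ne_zero hv hs (show j < n by omega)
    have h4 := hpn j (by omega)
    rw [h2]
    field_simp
  refine ⟨∑ j ∈ Finset.range (n + 1), (p j)⁻¹ • (ξ j).smulRight (x j), ⟨?_, ?_, ?_, ?_⟩, ?_⟩
  · intro z
    simp only [LinearMap.sum_apply, LinearMap.smul_apply, LinearMap.smulRight_apply, map_sum,
      map_smul, hξs]
    refine sum_range_eq_of_telescope (P := fun j => (p j)⁻¹ • ξ (j + 1) z • x j) ?_ ?_ ?_
    · simp [hx0]
    · intro j hj
      rw [hxe, ← hps j hj]
      module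
    · simp [hξn]
  · intro z
    simp only [LinearMap.sum_apply, LinearMap.smul_apply, LinearMap.smulRight_apply, map_sum,
      map_smul, hxs]
    symm
    refine sum_range_eq_of_telescope (P := fun j => (p j)⁻¹ • ξ j z • x (j + 1)) ?_ ?_ ?_
    · simp [hξ0]
    · intro j hj
      rw [hξf, ← hps j hj]
      module
    · simp [hxn]
  · intro z
    simp only [LinearMap.sum_apply, LinearMap.smul_apply, LinearMap.smulRight_apply, map_sum,
      map_smul, hxk, hξk]
    refine Finset.sum_congr rfl fun j _ => ?_
    module
  · intro z
    simp only [LinearMap.sum_apply, LinearMap.smul_apply, LinearMap.smulRight_apply, map_sum,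
      map_smul, hxl, hξl]
  · have heh := hR.e_eq_zero hs (mem_wt.1 hh).1
    rw [Finset.sum_range_succ']
    simp only [LinearMap.add_apply, LinearMap.sum_apply, LinearMap.smul_apply,
      LinearMap.smulRight_apply, ← hξs, heh, map_zero, zero_smul, smul_zero,
      Finset.sum_const_zero, zero_add]
    simp [hp, hξ, hx, hθh]

/-- The coefficient in `e (x (j + 1)) = nu • x j` for a mixed string. -/
def nu (v s : F) (n j : ℕ) : F :=
  s * v * (v - v⁻¹)⁻¹ ^ 2 * (v ^ (j + 1) - (v ^ (j + 1))⁻¹) *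
    (v ^ n / v ^ (j + 1) - v ^ (j + 1) / v ^ n)

lemma nu_ne_zero (hv : Generic v) {s : F} (hs : IsSign s) {n j : ℕ} (hj : j + 1 < n) :
    nu v s n j ≠ 0 := by
  obtain ⟨m, rfl⟩ := Nat.exists_eq_add_of_lt hj
  have h0 := hv.ne_zero
  have h1 := hv.sub_inv_ne_zero (n := m + 1) (by omega)
  have h2 := hv.sub_inv_ne_zero (n := j + 1) (by omega)
  have h3 : v ^ (j + 1 + m + 1) / v ^ (j + 1) - v ^ (j + 1) / v ^ (j + 1 + m + 1) =
      v ^ (m + 1) - (v ^ (m + 1))⁻¹ := by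
    field_simp
    ring
  rw [nu, h3]
  exact mul_ne_zero (mul_ne_zero (mul_ne_zero (mul_ne_zero hs.ne_zero h0)
    (pow_ne_zero _ (inv_ne_zero hv.quantum_ne_zero))) h2) h1

/-- Vectors `x j` with `l = 0` and `y j` with `l = 1`, `j < n`, on which the operators act as on
the simple module of dimension `2 n` whose highest weight is `s v ^ n`. -/
structure MixedString (R : WeakRep v V) (n : ℕ) (s : F) (x y : ℕ → V) : Prop where
  ex_zero : R.e (x 0) = 0
  ex : ∀ j, R.e (x (j + 1)) = nu v s n j • x j
  ey_zero : R.e (y 0) = (s * v / v ^ n) • x 0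
  ey : ∀ j, R.e (y (j + 1)) = (s * v / v ^ n) • x (j + 1) + ((v ^ 2)⁻¹ * nu v s n j) • y j
  fx : ∀ j, R.f (x j) = x (j + 1) + (v ^ j) ^ 2 • y j
  fy : ∀ j, R.f (y j) = y (j + 1)
  x_end : x n = 0
  y_end : y n = 0
  kx : ∀ j, R.k (x j) = (((v ^ j) ^ 2)⁻¹ * (s * v ^ n)) • x j
  ky : ∀ j, R.k (y j) = (((v ^ j) ^ 2)⁻¹ * ((v ^ 2)⁻¹ * (s * v ^ n))) • y j
  lx : ∀ j, R.l (x j) = 0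
  ly : ∀ j, R.l (y j) = y j

theorem MixedString.exists_intertwines (hv : Generic v) {R : WeakRep v V} {S : WeakRep v W}
    {n : ℕ} (hn : 0 < n) {s : F} (hs : IsSign s) {ξ η : ℕ → Dual F V} {x y : ℕ → W}
    (hξ : R.dual.MixedString n s ξ η) (hx : S.MixedString n s x y) {h : V} (heh : R.e h = 0)
    (hlh : R.l h = 0) (hh : ξ 0 h = 1) :
    ∃ α : V →ₗ[F] W, R.Intertwines S α ∧ α h = x 0 := by
  have hV := hv.ne_zero
  have hsn := hs.ne_zero
  have ha : s * v / v ^ n ≠ 0 := div_ne_zero (mul_ne_zero hsn hV) (pow_ne_zero _ hV)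
  have hxe0 := hx.ey_zero
  have hxe := hx.ey
  have hηf0 : ∀ z, η 0 (R.f z) = s * v / v ^ n * ξ 0 z := fun z =>
    LinearMap.congr_fun hξ.ey_zero z
  have hηf : ∀ j z, η (j + 1) (R.f z) =
      s * v / v ^ n * ξ (j + 1) z + ((v ^ 2)⁻¹ * nu v s n j) * η j z :=
    fun j z => LinearMap.congr_fun (hξ.ey j) z
  generalize s * v / v ^ n = a at ha hxe0 hxe hηf0 hηf
  set p : ℕ → F := fun j => ∏ i ∈ Finset.range j, nu v s n i with hp
  have hps : ∀ j, j + 1 < n → (p (j + 1))⁻¹ * nu v s n j = (p j)⁻¹ := by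
    intro j hj
    have h2 : p (j + 1) = p j * nu v s n j := Finset.prod_range_succ _ _
    have h3 := nu_ne_zero hv hs hj
    have h4 : p j ≠ 0 := by
      refine Finset.prod_ne_zero_iff.2 fun i hi => nu_ne_zero hv hs ?_
      have := Finset.mem_range.1 hi
      omega
    rw [h2]
    field_simp
  have hξf0 : ∀ z, ξ 0 (R.f z) = 0 := fun z => LinearMap.congr_fun hξ.ex_zero z
  have hξf : ∀ j z, ξ (j + 1) (R.f z) = nu v s n j * ξ j z := fun j z =>
    LinearMap.congr_fun (hξ.ex j) z
  have hξe : ∀ j z, ξ j (R.e z) = ξ (j + 1) z + (v ^ j) ^ 2 * η j z := fun j z =>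
    LinearMap.congr_fun (hξ.fx j) z
  have hηe : ∀ j z, η j (R.e z) = η (j + 1) z := fun j z => LinearMap.congr_fun (hξ.fy j) z
  have hξk : ∀ j z, ξ j (R.k z) = (((v ^ j) ^ 2)⁻¹ * (s * v ^ n)) * ξ j z := fun j z =>
    LinearMap.congr_fun (hξ.kx j) z
  have hηk : ∀ j z, η j (R.k z) = (((v ^ j) ^ 2)⁻¹ * ((v ^ 2)⁻¹ * (s * v ^ n))) * η j z :=
    fun j z => LinearMap.congr_fun (hξ.ky j) z
  have hξl : ∀ j z, ξ j (R.l z) = 0 := fun j z => LinearMap.congr_fun (hξ.lx j) z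
  have hηl : ∀ j z, η j (R.l z) = η j z := fun j z => LinearMap.congr_fun (hξ.ly j) z
  have hend : n - 1 + 1 = n := by omega
  refine ⟨∑ j ∈ Finset.range n, (p j)⁻¹ • ((ξ j).smulRight (x j) +
    ((v ^ j) ^ 2 * a⁻¹) • (η j).smulRight (y j)), ⟨?_, ?_, ?_, ?_⟩, ?_⟩
  · intro z
    simp only [LinearMap.sum_apply, LinearMap.smul_apply, LinearMap.add_apply,
      LinearMap.smulRight_apply, map_sum, map_smul, map_add, hξe, hηe]
    refine sum_range_eq_of_telescope (P := fun j => (p j)⁻¹ • (ξ (j + 1) z • x j +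
      ((v ^ j) ^ 2 * a⁻¹) • η (j + 1) z • y j)) ?_ ?_ ?_
    · rw [hx.ex_zero, hxe0]
      match_scalars <;> field_simp <;> ring
    · intro j hj
      rw [hx.ex, hxe, ← hps j hj]
      match_scalars <;> field_simp <;> ring
    · simp [hend, hξ.x_end, hξ.y_end]
  · intro z
    simp only [LinearMap.sum_apply, LinearMap.smul_apply, LinearMap.add_apply,
      LinearMap.smulRight_apply, map_sum, map_smul, map_add, hx.fx, hx.fy]
    symm
    refine sum_range_eq_of_telescope (P := fun j => (p j)⁻¹ • (ξ j z • x (j + 1) +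
      ((v ^ j) ^ 2 * a⁻¹) • η j z • y (j + 1))) ?_ ?_ ?_
    · rw [hξf0, hηf0]
      match_scalars <;> field_simp <;> ring
    · intro j hj
      rw [hξf, hηf, ← hps j hj]
      match_scalars <;> field_simp <;> ring
    · simp [hend, hx.x_end, hx.y_end]
  · intro z
    simp only [LinearMap.sum_apply, LinearMap.smul_apply, LinearMap.add_apply,
      LinearMap.smulRight_apply, map_sum, map_smul, map_add, hx.kx, hx.ky, hξk, hηk]
    refine Finset.sum_congr rfl fun j _ => ?_
    module
  · intro z
    simp only [LinearMap.sum_apply, LinearMap.smul_apply, LinearMap.add_apply,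
      LinearMap.smulRight_apply, map_sum, map_smul, map_add, hx.lx, hx.ly, hξl, hηl,
      zero_smul, smul_zero]
  · obtain ⟨m, rfl⟩ : ∃ m, n = m + 1 := ⟨n - 1, by omega⟩
    have hηh : ∀ j, η j h = 0 := by
      intro j
      rw [← hηl, hlh, map_zero]
    have hξh : ∀ j, ξ (j + 1) h = 0 := by
      intro j
      have := hξe j h
      rw [heh, map_zero, hηh, mul_zero, add_zero] at this
      exact this.symm
    rw [Finset.sum_range_succ']
    simp [hηh, hξh, hh, hp]

end Strings

section MixedString

variable {F : Type*} [Field F] {v : F} {V : Type*} [AddCommGroup V] [Module F V]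

lemma k'l (R : WeakRep v V) (x : V) : R.k' (R.l x) = R.l (R.k' x) := by
  have := R.kl (R.k' x)
  rw [R.kk'] at this
  rw [← this, R.k'k]

/-- The component of `f` with values in the kernel of `l`. -/
def fzero (R : WeakRep v V) : Module.End F V := R.f - R.l ∘ₗ R.f

lemma fzero_apply (R : WeakRep v V) (z : V) : R.fzero z = R.f z - R.l (R.f z) := rfl

lemma l_fzero_pow (R : WeakRep v V) {z : V} (hz : R.l z = 0) (j : ℕ) :
    R.l ((R.fzero ^ j) z) = 0 := by
  cases j with
  | zero => simpa using hz
  | succ j => simp [pow_succ', Module.End.mul_apply, fzero_apply, R.ll]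

lemma l_f_pow (R : WeakRep v V) {z : V} (hz : R.l z = z) (j : ℕ) :
    R.l ((R.f ^ j) z) = (R.f ^ j) z := by
  induction j with
  | zero => simpa using hz
  | succ j ih => rw [pow_succ', Module.End.mul_apply, ← ih, R.lfl]

lemma Serre.l_f_fzero {R : WeakRep v V} (hR : R.Serre) (hv : Generic v) {z : V} (hz : R.l z = 0) :
    R.l (R.f (R.fzero z)) = v ^ 2 • R.f (R.l (R.f z)) := by
  have h0 := hv.ne_zero
  have h := congrArg (fun w => v • w) (hR.serreF z)
  simp only [hz, map_zero, smul_zero, add_zero, smul_smul, mul_inv_cancel₀ h0, one_smul] at h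
  rw [fzero_apply, map_sub, map_sub, R.lfl, ← h]
  match_scalars
  field_simp
  ring

lemma Serre.l_f_fzero_pow {R : WeakRep v V} (hR : R.Serre) (hv : Generic v) {z : V}
    (hz : R.l z = 0) (j : ℕ) :
    R.l (R.f ((R.fzero ^ j) z)) = (v ^ j) ^ 2 • (R.f ^ j) (R.l (R.f z)) := by
  induction j with
  | zero => simp
  | succ j ih =>
    rw [pow_succ', Module.End.mul_apply, hR.l_f_fzero hv (R.l_fzero_pow hz j), ih, map_smul,
      smul_smul, pow_succ' R.f, Module.End.mul_apply]
    congr 1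
    ring

lemma Serre.f_fzero_pow {R : WeakRep v V} (hR : R.Serre) (hv : Generic v) {z : V}
    (hz : R.l z = 0) (j : ℕ) :
    R.f ((R.fzero ^ j) z) = (R.fzero ^ (j + 1)) z + (v ^ j) ^ 2 • (R.f ^ j) (R.l (R.f z)) := by
  rw [← hR.l_f_fzero_pow hv hz, pow_succ', Module.End.mul_apply, fzero_apply, sub_add_cancel]

/-- The coefficient of `f ^ j (l (f z))` in `f ^ (j + 1) z` for `l z = 0`. -/
def gam (v : F) (j : ℕ) : F := v ^ j * (v ^ (j + 1) - (v ^ (j + 1))⁻¹) * (v - v⁻¹)⁻¹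

lemma gam_ne_zero (hv : Generic v) (j : ℕ) : gam v j ≠ 0 :=
  mul_ne_zero (mul_ne_zero (pow_ne_zero _ hv.ne_zero) (hv.sub_inv_ne_zero (Nat.succ_pos j)))
    (inv_ne_zero hv.quantum_ne_zero)

lemma Serre.f_pow_succ {R : WeakRep v V} (hR : R.Serre) (hv : Generic v) {z : V}
    (hz : R.l z = 0) (j : ℕ) :
    (R.f ^ (j + 1)) z = (R.fzero ^ (j + 1)) z + gam v j • (R.f ^ j) (R.l (R.f z)) := by
  have h0 := hv.ne_zero
  have h1 := hv.sq_sub_one_ne_zero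
  induction j with
  | zero =>
    have : gam v 0 = 1 := by
      simp [gam, hv.quantum_ne_zero]
    simp [this, fzero_apply]
  | succ j ih =>
    have hg : gam v (j + 1) = (v ^ (j + 1)) ^ 2 + gam v j := by
      simp only [gam]
      field_simp
      ring
    rw [pow_succ', Module.End.mul_apply, ih, map_add, hR.f_fzero_pow hv hz, map_smul, hg, add_smul,
      add_assoc, pow_succ' R.f j, Module.End.mul_apply]

lemma e_f_pow_sub (R : WeakRep v V) {z : V} (hz : R.l z = z) (j : ℕ) :
    R.e ((R.f ^ j) z) - R.l (R.e ((R.f ^ j) z)) = (R.fzero ^ j) (R.e z - R.l (R.e z)) := by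
  induction j with
  | zero => simp
  | succ j ih =>
    have hw := R.l_f_pow hz j
    rw [pow_succ', Module.End.mul_apply, pow_succ', Module.End.mul_apply, ← ih]
    generalize (R.f ^ j) z = w at hw
    have hk : R.l (R.k w) = R.k w := by rw [← R.kl, hw]
    have hk' : R.l (R.k' w) = R.k' w := by rw [← R.k'l, hw]
    rw [R.ef, fzero_apply]
    simp only [map_sub, map_add, map_smul, hk, hk', R.lfl]
    abel

lemma k_fzero_pow_of_wt (R : WeakRep v V) (hv : v ≠ 0) {c : F} {x : V}
    (hk : R.k x = c • x) (j : ℕ) :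
    R.k ((R.fzero ^ j) x) = (((v ^ j) ^ 2)⁻¹ * c) • (R.fzero ^ j) x := by
  induction j with
  | zero => simpa using hk
  | succ j ih =>
    rw [pow_succ', Module.End.mul_apply, fzero_apply, map_sub, R.kl, R.kf hv, ih]
    simp only [map_smul, smul_sub, smul_smul]
    congr 2 <;>
    · field_simp
      ring

/-- A vector of highest weight `s v ^ n` with `l = 0` generates a mixed string when neither the
weight `(s v ^ n, 1)` nor the weight `(s v ^ (-n), 0)` occurs. -/
theorem Serre.mixedString {R : WeakRep v V} (hR : R.Serre) (hv : Generic v) {s : F} (hs : IsSign s)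
    {n : ℕ} (hn : 0 < n) (hB : R.Bounded n) (h1 : R.wt (s * v ^ n) 1 = ⊥)
    (h2 : R.wt (s * (v ^ n)⁻¹) 0 = ⊥) {h : V} (hh : h ∈ R.wt (s * v ^ n) 0) :
    R.MixedString n s (fun j => (R.fzero ^ j) h) (fun j => (R.f ^ j) (R.l (R.f h))) := by
  obtain ⟨hk, hl⟩ := mem_wt.1 hh
  rw [zero_smul] at hl
  have h0 := hv.ne_zero
  have hq := hv.sq_sub_one_ne_zero
  have he := hB.e_eq_zero hs hk
  have hkf : R.k (R.l (R.f h)) = ((v ^ 2)⁻¹ * (s * v ^ n)) • R.l (R.f h) := by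
    rw [R.kl, R.kf h0, hk, map_smul, map_smul, map_smul, smul_smul]
  have hly : ∀ j, R.l ((R.f ^ j) (R.l (R.f h))) = (R.f ^ j) (R.l (R.f h)) :=
    R.l_f_pow (R.ll _)
  have hlx : ∀ j, R.l ((R.fzero ^ j) h) = 0 := R.l_fzero_pow hl
  have hxn : (R.fzero ^ n) h = 0 := by
    have : (R.fzero ^ n) h ∈ R.wt (s * (v ^ n)⁻¹) 0 := by
      refine mem_wt.2 ⟨?_, by rw [hlx, zero_smul]⟩
      rw [R.k_fzero_pow_of_wt h0 hk]
      congr 1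
      field_simp
    rwa [h2, Submodule.mem_bot] at this
  set u : V := R.e (R.l (R.f h)) with hu
  have hku : R.k u = (s * v ^ n) • u := by
    rw [hu, R.ke, hkf, map_smul, smul_smul]
    congr 1
    field_simp
  have hlu : R.l u = 0 := by
    have : R.l u ∈ R.wt (s * v ^ n) 1 :=
      mem_wt.2 ⟨by rw [R.kl, hku, map_smul], by rw [R.ll, one_smul]⟩
    rwa [h1, Submodule.mem_bot] at this
  have hey : ∀ j, R.e ((R.f ^ j) (R.l (R.f h))) =
      (R.fzero ^ j) u + R.l (R.e ((R.f ^ j) (R.l (R.f h)))) := by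
    intro j
    have := R.e_f_pow_sub (R.ll (R.f h)) j
    rw [← hu, hlu, sub_zero] at this
    rw [← this, sub_add_cancel]
  have hef : ∀ j, R.e ((R.fzero ^ (j + 1)) h) + gam v j • R.e ((R.f ^ j) (R.l (R.f h))) =
      mu v s n j • (R.f ^ j) h := by
    intro j
    rw [← R.e_f_pow_of_wt hv hs he hk, hR.f_pow_succ hv hl, map_add, map_smul]
  have hlex : ∀ j, R.l (R.e ((R.fzero ^ j) h)) = 0 := by
    intro j
    rw [← R.lel, hlx, map_zero, map_zero]
  have hpart : ∀ j, (R.f ^ j) h - R.l ((R.f ^ j) h) = (R.fzero ^ j) h := by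
    intro j
    cases j with
    | zero => simp [hl]
    | succ j =>
      rw [hR.f_pow_succ hv hl]
      simp only [map_add, map_smul, hly, hlx, zero_add, add_sub_cancel_right]
  have hex' : ∀ j, R.e ((R.fzero ^ (j + 1)) h) =
      mu v s n j • (R.fzero ^ j) h - gam v j • (R.fzero ^ j) u := by
    intro j
    have h3 := congrArg R.l (hef j)
    simp only [map_add, map_smul, hlex, zero_add] at h3
    linear_combination (norm := module) hef j - h3 - gam v j • hey j + (mu v s n j) • hpart j
  have hgm : ∀ j, mu v s n j - gam v j * (s * v / v ^ n) = nu v s n j := by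
    intro j
    simp only [mu, gam, nu]
    field_simp
    ring
  have huh : u = (s * v / v ^ n) • h := by
    obtain ⟨m, rfl⟩ : ∃ m, n = m + 1 := ⟨n - 1, by omega⟩
    have h3 := hex' m
    rw [hxn, map_zero] at h3
    have h4 : (R.fzero ^ m) (mu v s (m + 1) m • h - gam v m • u) = 0 := by
      rw [map_sub, map_smul, map_smul, ← h3]
    have h5 : R.l (mu v s (m + 1) m • h - gam v m • u) = 0 := by
      simp [hl, hlu]
    have h6 : R.k (mu v s (m + 1) m • h - gam v m • u) =
        (s * v ^ (m + 1)) • (mu v s (m + 1) m • h - gam v m • u) := by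
      simp only [map_sub, map_smul, hk, hku]
      module
    have h7 : (R.f ^ (m + 1)) (mu v s (m + 1) m • h - gam v m • u) = 0 := by
      have h8 := hR.l_f_fzero_pow hv h5 m
      rw [h4, map_zero, map_zero] at h8
      have h9 := (smul_eq_zero.1 h8.symm).resolve_left (pow_ne_zero _ (pow_ne_zero _ h0))
      rw [hR.f_pow_succ hv h5, h9, pow_succ', Module.End.mul_apply, h4, map_zero, smul_zero,
        add_zero]
    have h8 := R.eq_zero_of_f_pow_eq_zero hv hs (hB.e_eq_zero hs h6) h6 le_rfl h7
    have h9 : mu v s (m + 1) m = gam v m * (s * v / v ^ (m + 1)) := by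
      have := hgm m
      rw [nu, div_self (pow_ne_zero _ h0), sub_self, mul_zero] at this
      exact sub_eq_zero.1 this
    rw [h9, mul_smul, ← smul_sub] at h8
    exact (sub_eq_zero.1 ((smul_eq_zero.1 h8).resolve_left (gam_ne_zero hv m))).symm
  refine ⟨?_, ?_, ?_, ?_, ?_, ?_, ?_, ?_, ?_, ?_, ?_, ?_⟩
  · simpa using he
  · intro j
    simp only [hex', huh, map_smul]
    rw [← hgm]
    module
  · simpa using huh
  · intro j
    have h3 := congrArg R.l (hef (j + 1))
    rw [map_add, hlex, zero_add, map_smul, map_smul, hR.f_pow_succ hv hl, map_add, map_smul, hly,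
      hlx, zero_add, smul_smul] at h3
    have hg := gam_ne_zero hv (j + 1)
    refine (hey (j + 1)).trans ?_
    rw [huh, map_smul]
    congr 1
    rw [← inv_smul_smul₀ hg (R.l _), h3, smul_smul]
    congr 1
    have h4 := hv.sub_inv_ne_zero (Nat.succ_pos (j + 1))
    have h5 : mu v s n (j + 1) * gam v j = gam v (j + 1) * ((v ^ 2)⁻¹ * nu v s n j) := by
      simp only [mu, gam, nu]
      field_simp
      ring
    rw [h5, inv_mul_cancel_left₀ hg]
  · exact hR.f_fzero_pow hv hl
  · intro j
    simp only [pow_succ', Module.End.mul_apply]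
  · exact hxn
  · refine hB s hs (-(n + 2 : ℕ)) ?_ _ ?_
    · rw [abs_neg, abs_of_nonneg (by positivity)]
      push_cast
      omega
    · rw [R.k_f_pow_of_wt h0 hkf, zpow_neg, zpow_natCast]
      congr 1
      field_simp
      ring
  · exact R.k_fzero_pow_of_wt h0 hk
  · exact R.k_f_pow_of_wt h0 hkf
  · exact hlx
  · exact hly

variable {W : Type*} [AddCommGroup W] [Module F W]

/-- Vectors of extremal weight with `l = 0` are exchanged by intertwiners. -/
theorem exists_intertwines_of_wt_zero [FiniteDimensional F V] (hv : Generic v)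
    {R : WeakRep v V} {S : WeakRep v W} (hRs : R.Serre) (hSs : S.Serre) {n : ℕ} (hn : 0 < n)
    {s : F} (hs : IsSign s) (hR : R.Bounded n) (hS : S.Bounded n)
    (hR1 : R.wt (s * v ^ n) 1 = ⊥) (hR0 : R.wt (s * (v ^ n)⁻¹) 0 = ⊥)
    (hS1 : S.wt (s * v ^ n) 1 = ⊥) (hS0 : S.wt (s * (v ^ n)⁻¹) 0 = ⊥)
    {h : V} (hh : h ∈ R.wt (s * v ^ n) 0) (h0 : h ≠ 0) {h' : W} (hh' : h' ∈ S.wt (s * v ^ n) 0) :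
    ∃ α : V →ₗ[F] W, R.Intertwines S α ∧ α h = h' := by
  obtain ⟨θ, hθ, hθh⟩ := hR.exists_dual hv hs (Or.inl rfl) hh h0
  obtain ⟨hk, hl⟩ := mem_wt.1 hh
  rw [zero_smul] at hl
  have hξ := hRs.dual.mixedString hv hs hn hR.dual (dual_wt_eq_bot (Or.inr rfl) hR1)
    (dual_wt_eq_bot (Or.inl rfl) hR0) hθ
  have hx := hSs.mixedString hv hs hn hS hS1 hS0 hh'
  simpa using hξ.exists_intertwines hv hn hs hx (hR.e_eq_zero hs hk) hl (by simpa using hθh)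

end MixedString

section Existence

variable {F : Type*} [Field F] {v : F} {V : Type*} [AddCommGroup V] [Module F V]

lemma exists_f_pow_eq_zero [FiniteDimensional F V] (hv : Generic v) (R : WeakRep v V) :
    ∃ m, R.f ^ m = 0 := by
  by_contra! hf
  have h0 := hv.ne_zero
  let T : Module.End F (Module.End F V) :=
    LinearMap.mulLeft F R.k ∘ₗ LinearMap.mulRight F R.k'
  have hT : ∀ m : ℕ, T.HasEigenvalue (v ^ (-(2 * m) : ℤ)) := by
    intro m
    refine Module.End.hasEigenvalue_of_hasEigenvector (x := R.f ^ m)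
      ⟨Module.End.mem_eigenspace_iff.2 ?_, hf m⟩
    ext x
    have h1 : v ^ (-(2 * m) : ℤ) = ((v ^ m) ^ 2)⁻¹ := by
      rw [zpow_neg, ← pow_mul, mul_comm m, ← zpow_natCast]
      push_cast
      rfl
    simp [T, R.k_f_pow h0, R.kk', h1]
  refine Set.infinite_of_injective_forall_mem (f := fun m : ℕ => v ^ (-(2 * m) : ℤ)) ?_ hT
    (Module.End.finite_hasEigenvalue T)
  intro a b hab
  have := hv.zpow_injective hab
  omega

lemma exists_e_eq_zero [FiniteDimensional F V] [Nontrivial V] (hv : Generic v)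
    (R : WeakRep v V) : ∃ x, x ≠ 0 ∧ R.e x = 0 := by
  by_contra! he
  obtain ⟨m, hm⟩ := R.twist.exists_f_pow_eq_zero hv
  obtain ⟨x, hx⟩ := exists_ne (0 : V)
  have key : ∀ j, (R.e ^ j) x ≠ 0 := by
    intro j
    induction j with
    | zero => simpa using hx
    | succ j ih =>
      rw [pow_succ', Module.End.mul_apply]
      exact he _ ih
  exact key m (LinearMap.congr_fun hm x)

lemma exists_eigenvector_of_f_pow_eq_zero (hv : Generic v) (R : WeakRep v V) (m : ℕ) {x : V}
    (hx : x ≠ 0) (he : R.e x = 0) (hf : (R.f ^ m) x = 0) :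
    ∃ s : F, IsSign s ∧ ∃ a : ℤ, ∃ y, y ≠ 0 ∧ R.k y = (s * v ^ a) • y := by
  have h0 := hv.ne_zero
  induction m generalizing x with
  | zero => exact absurd (by simpa using hf) hx
  | succ m ih =>
    have h1 := R.e_f_pow_succ hv he m
    rw [hf, map_zero] at h1
    have h2 := (smul_eq_zero.1 h1.symm).resolve_left
      (mul_ne_zero (pow_ne_zero _ (inv_ne_zero hv.quantum_ne_zero))
        (hv.sub_inv_ne_zero (Nat.succ_pos m)))
    by_cases h3 : (v ^ m)⁻¹ • R.k x - v ^ m • R.k' x = 0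
    · have h4 : R.k (R.k x) = (v ^ m) ^ 2 • x := by
        have h5 := congrArg (fun z => v ^ m • R.k z) h3
        simp only [map_sub, map_smul, R.kk', smul_sub, map_zero, smul_zero,
          smul_inv_smul₀ (pow_ne_zero m h0), smul_smul, ← sq] at h5
        exact sub_eq_zero.1 h5
      by_cases h5 : R.k x + v ^ m • x = 0
      · refine ⟨-1, Or.inr rfl, m, x, hx, ?_⟩
        rw [zpow_natCast, neg_one_mul, neg_smul]
        exact eq_neg_of_add_eq_zero_left h5
      · refine ⟨1, Or.inl rfl, m, _, h5, ?_⟩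
        rw [zpow_natCast, map_add, map_smul, h4]
        module
    · refine ih h3 ?_ h2
      have hke : R.e (R.k x) = 0 := by
        have := R.ke x
        rw [he, map_zero] at this
        exact (smul_eq_zero.1 this.symm).resolve_left (pow_ne_zero _ h0)
      have hk'e : R.e (R.k' x) = 0 := by
        have := R.ke (R.k' x)
        rw [R.kk', he, smul_zero] at this
        rw [← R.k'k (R.e _), this, map_zero]
      simp [hke, hk'e]

lemma eq_zero_of_wt_eq_bot {R : WeakRep v V} {c : F} (h : ∀ ε : F, ε = 0 ∨ ε = 1 → R.wt c ε = ⊥)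
    {x : V} (hx : R.k x = c • x) : x = 0 := by
  have key : ∀ ε : F, ε = 0 ∨ ε = 1 → R.proj ε x = 0 := by
    intro ε hε
    have : R.proj ε x ∈ R.wt c ε :=
      mem_wt.2 ⟨by rw [R.k_proj, hx, map_smul], R.l_proj hε x⟩
    rwa [h ε hε, Submodule.mem_bot] at this
  have : x = R.proj 0 x + R.proj 1 x := by simp [proj]
  rw [this, key 0 (Or.inl rfl), key 1 (Or.inr rfl), add_zero]

lemma Bounded.wt_eq_bot {R : WeakRep v V} {n : ℕ} (h : R.Bounded n) {s : F} (hs : IsSign s)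
    {a : ℤ} (ha : (n : ℤ) < |a|) (ε : F) : R.wt (s * v ^ a) ε = ⊥ := by
  rw [eq_bot_iff]
  intro x hx
  exact h s hs a ha x (mem_wt.1 hx).1

/-- A nonzero finite dimensional representation has a weight `± v ^ a` with `|a|` maximal. -/
lemma exists_bounded [FiniteDimensional F V] [Nontrivial V] (hv : Generic v) (R : WeakRep v V) :
    ∃ n, R.Bounded n ∧ ∃ s : F, IsSign s ∧ ∃ a : ℤ, |a| = n ∧ ∃ ε : F, (ε = 0 ∨ ε = 1) ∧
      R.wt (s * v ^ a) ε ≠ ⊥ := by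
  set A : Set ℤ := {a | ∃ s : F, IsSign s ∧ ∃ y, y ≠ 0 ∧ R.k y = (s * v ^ a) • y} with hA
  have hne : A.Nonempty := by
    obtain ⟨x, hx, he⟩ := R.exists_e_eq_zero hv
    obtain ⟨m, hm⟩ := R.exists_f_pow_eq_zero hv
    obtain ⟨s, hs, a, h⟩ := R.exists_eigenvector_of_f_pow_eq_zero hv m hx he (by simp [hm])
    exact ⟨a, s, hs, h⟩
  have hfin : A.Finite := by
    have hinj : Function.Injective (fun a : ℤ => v ^ (2 * a)) := by
      intro a b hab
      have := hv.zpow_injective hab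
      omega
    refine ((Module.End.finite_hasEigenvalue (R.k ∘ₗ R.k)).preimage hinj.injOn).subset ?_
    rintro a ⟨s, hs, y, hy, hk⟩
    refine Module.End.hasEigenvalue_of_hasEigenvector (x := y)
      ⟨Module.End.mem_eigenspace_iff.2 ?_, hy⟩
    rw [LinearMap.comp_apply, hk, map_smul, hk, smul_smul]
    congr 1
    rw [mul_mul_mul_comm, hs.mul_self, one_mul, ← zpow_add₀ hv.ne_zero, ← two_mul]
  obtain ⟨a, ⟨s, hs, y, hy, hk⟩, hmax⟩ := Set.exists_max_image A (fun a => |a|) hfin hne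
  have hn : |a| = (a.natAbs : ℤ) := Int.abs_eq_natAbs a
  refine ⟨a.natAbs, ?_, s, hs, a, hn, ?_⟩
  · intro t ht b hb x hx
    by_contra hx0
    have := hmax b ⟨t, ht, x, hx0, hx⟩
    omega
  · by_contra! hbot
    exact hy (eq_zero_of_wt_eq_bot hbot hk)

end Existence

section Isomorphism

variable {F : Type*} [Field F] {v : F}

/-- The weight spaces of weights `(± v ^ a, ε)` with `ε ∈ {0, 1}` have equal dimensions. -/
def SameWeights {V W : Type*} [AddCommGroup V] [Module F V] [AddCommGroup W] [Module F W]
    (R : WeakRep v V) (S : WeakRep v W) : Prop :=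
  ∀ s : F, IsSign s → ∀ a : ℤ, ∀ ε : F, ε = 0 ∨ ε = 1 →
    finrank F (R.wt (s * v ^ a) ε) = finrank F (S.wt (s * v ^ a) ε)

section

variable {V W : Type*} [AddCommGroup V] [Module F V] [AddCommGroup W] [Module F W]

lemma SameWeights.symm {R : WeakRep v V} {S : WeakRep v W} (h : R.SameWeights S) :
    S.SameWeights R := fun s hs a ε hε => (h s hs a ε hε).symm

lemma SameWeights.wt_eq_bot [FiniteDimensional F V] [FiniteDimensional F W] {R : WeakRep v V}
    {S : WeakRep v W} (h : R.SameWeights S) {s : F} (hs : IsSign s) {a : ℤ} {ε : F}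
    (hε : ε = 0 ∨ ε = 1) (hR : R.wt (s * v ^ a) ε = ⊥) : S.wt (s * v ^ a) ε = ⊥ := by
  rw [← Submodule.finrank_eq_zero] at hR ⊢
  rw [← h s hs a ε hε, hR]

lemma SameWeights.bounded [FiniteDimensional F V] [FiniteDimensional F W] {R : WeakRep v V}
    {S : WeakRep v W} (h : R.SameWeights S) {n : ℕ} (hR : R.Bounded n) : S.Bounded n :=
  fun _ hs _ ha _ hx =>
    eq_zero_of_wt_eq_bot (fun ε hε => h.wt_eq_bot hs hε (hR.wt_eq_bot hs ha ε)) hx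

lemma twist_wt (hv : Generic v) (R : WeakRep v V) {s : F} (hs : IsSign s) (n : ℕ) :
    R.twist.wt (s * v ^ n) 1 = R.wt (s * (v ^ n)⁻¹) 0 := by
  have hc : s * v ^ n ≠ 0 := mul_ne_zero hs.ne_zero (pow_ne_zero _ hv.ne_zero)
  have hc' : s * (v ^ n)⁻¹ = (s * v ^ n)⁻¹ := by rw [mul_inv, hs.inv_eq]
  ext x
  rw [mem_wt, mem_wt, hc']
  refine and_congr ⟨fun h => R.twist.k'_eq hc h, fun h => ?_⟩ ?_
  · have := R.k'_eq (inv_ne_zero hc) h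
    rwa [inv_inv] at this
  · simp [twist]

/-- Representations with the same weights have intertwiners in both directions whose composite
fixes a nonzero vector. -/
theorem SameWeights.exists_intertwines [FiniteDimensional F V] [FiniteDimensional F W]
    [Nontrivial V] (hv : Generic v) {R : WeakRep v V} {S : WeakRep v W} (hRs : R.Serre)
    (hSs : S.Serre) (h : R.SameWeights S) :
    ∃ (α : V →ₗ[F] W) (β : W →ₗ[F] V) (x : V), R.Intertwines S α ∧ S.Intertwines R β ∧ x ≠ 0 ∧
      β (α x) = x := by
  have h0 := hv.ne_zero
  obtain ⟨n, hR, s, hs, a, ha, ε, hε, hw⟩ := R.exists_bounded hv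
  have hS := h.bounded hR
  have hpos : ∀ t : F, IsSign t → ∀ δ : F, δ = 0 ∨ δ = 1 →
      (R.wt (t * v ^ n) δ = ⊥ ↔ S.wt (t * v ^ n) δ = ⊥) := by
    intro t ht δ hδ
    rw [← zpow_natCast]
    exact ⟨h.wt_eq_bot ht hδ, h.symm.wt_eq_bot ht hδ⟩
  have hneg : ∀ t : F, IsSign t → ∀ δ : F, δ = 0 ∨ δ = 1 →
      (R.wt (t * (v ^ n)⁻¹) δ = ⊥ ↔ S.wt (t * (v ^ n)⁻¹) δ = ⊥) := by
    intro t ht δ hδ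
    rw [← zpow_natCast, ← zpow_neg]
    exact ⟨h.wt_eq_bot ht hδ, h.symm.wt_eq_bot ht hδ⟩
  by_cases h1 : ∃ t : F, IsSign t ∧ R.wt (t * v ^ n) 1 ≠ ⊥
  · obtain ⟨t, ht, hx⟩ := h1
    obtain ⟨y, hy, hy0⟩ := Submodule.exists_mem_ne_zero_of_ne_bot
      ((hpos t ht 1 (Or.inr rfl)).not.1 hx)
    obtain ⟨x, hx, hx0⟩ := Submodule.exists_mem_ne_zero_of_ne_bot hx
    obtain ⟨α, hα, hαx⟩ := exists_intertwines_of_wt_one hv ht hR hS hx hx0 hy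
    obtain ⟨β, hβ, hβy⟩ := exists_intertwines_of_wt_one hv ht hS hR hy hy0 hx
    exact ⟨α, β, x, hα, hβ, hx0, by rw [hαx, hβy]⟩
  by_cases h2 : ∃ t : F, IsSign t ∧ R.wt (t * (v ^ n)⁻¹) 0 ≠ ⊥
  · obtain ⟨t, ht, hx⟩ := h2
    obtain ⟨y, hy, hy0⟩ := Submodule.exists_mem_ne_zero_of_ne_bot
      ((hneg t ht 0 (Or.inl rfl)).not.1 hx)
    obtain ⟨x, hx, hx0⟩ := Submodule.exists_mem_ne_zero_of_ne_bot hx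
    rw [← twist_wt hv _ ht] at hx hy
    obtain ⟨α, hα, hαx⟩ :=
      exists_intertwines_of_wt_one hv ht (hR.twist hv) (hS.twist hv) hx hx0 hy
    obtain ⟨β, hβ, hβy⟩ :=
      exists_intertwines_of_wt_one hv ht (hS.twist hv) (hR.twist hv) hy hy0 hx
    exact ⟨α, β, x, hα.of_twist, hβ.of_twist, hx0, by rw [hαx, hβy]⟩
  push Not at h1 h2
  have hx : R.wt (s * v ^ n) 0 ≠ ⊥ := by
    rcases (abs_eq (Int.natCast_nonneg n)).1 ha with rfl | rfl
    · rw [zpow_natCast] at hw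
      rcases hε with rfl | rfl
      · exact hw
      · exact absurd (h1 s hs) hw
    · rw [zpow_neg, zpow_natCast] at hw
      rcases hε with rfl | rfl
      · exact absurd (h2 s hs) hw
      · obtain ⟨x, hx, hx0⟩ := Submodule.exists_mem_ne_zero_of_ne_bot hw
        have hc : s * (v ^ n)⁻¹ ≠ 0 :=
          mul_ne_zero hs.ne_zero (inv_ne_zero (pow_ne_zero _ h0))
        have hk : R.twist.k x = (s * v ^ n) • x := by
          have := R.k'_eq hc (mem_wt.1 hx).1
          rwa [mul_inv, inv_inv, hs.inv_eq] at this
        have hy0 : (R.twist.f ^ n) x ≠ 0 := fun hy => hx0 <|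
          R.twist.eq_zero_of_f_pow_eq_zero hv hs ((hR.twist hv).e_eq_zero hs hk) hk le_rfl hy
        have hky : R.k ((R.twist.f ^ n) x) = (s * v ^ n) • (R.twist.f ^ n) x := by
          have h3 := R.twist.k_f_pow_of_wt h0 hk n
          have h4 : ((v ^ n) ^ 2)⁻¹ * (s * v ^ n) = s * (v ^ n)⁻¹ := by
            field_simp
          rw [h4] at h3
          have := R.twist.k'_eq hc h3
          rwa [mul_inv, inv_inv, hs.inv_eq] at this
        intro hbot
        refine hy0 (eq_zero_of_wt_eq_bot (fun δ hδ => ?_) hky)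
        rcases hδ with rfl | rfl
        · exact hbot
        · exact h1 s hs
  have hn : 0 < n := by
    rw [Nat.pos_iff_ne_zero]
    rintro rfl
    have := h2 s hs
    simp only [pow_zero, inv_one] at this hx
    exact hx this
  obtain ⟨y, hy, hy0⟩ := Submodule.exists_mem_ne_zero_of_ne_bot
    ((hpos s hs 0 (Or.inl rfl)).not.1 hx)
  obtain ⟨x, hx, hx0⟩ := Submodule.exists_mem_ne_zero_of_ne_bot hx
  have hR1 := h1 s hs
  have hR0 := h2 s hs
  have hS1 := (hpos s hs 1 (Or.inr rfl)).1 hR1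
  have hS0 := (hneg s hs 0 (Or.inl rfl)).1 hR0
  obtain ⟨α, hα, hαx⟩ :=
    exists_intertwines_of_wt_zero hv hRs hSs hn hs hR hS hR1 hR0 hS1 hS0 hx hx0 hy
  obtain ⟨β, hβ, hβy⟩ :=
    exists_intertwines_of_wt_zero hv hSs hRs hn hs hS hR hS1 hS0 hR1 hR0 hy hy0 hx
  exact ⟨α, β, x, hα, hβ, hx0, by rw [hαx, hβy]⟩

lemma Intertwines.comp {U : Type*} [AddCommGroup U] [Module F U] {Q : WeakRep v U}
    {R : WeakRep v V} {S : WeakRep v W} {β : V →ₗ[F] W} {α : U →ₗ[F] V} (hβ : R.Intertwines S β)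
    (hα : Q.Intertwines R α) : Q.Intertwines S (β ∘ₗ α) where
  e x := by simp [hα.e, hβ.e]
  f x := by simp [hα.f, hβ.f]
  k x := by simp [hα.k, hβ.k]
  l x := by simp [hα.l, hβ.l]

lemma Intertwines.pow {R : WeakRep v V} {φ : Module.End F V} (h : R.Intertwines R φ) (m : ℕ) :
    R.Intertwines R (φ ^ m) := by
  induction m with
  | zero => exact ⟨fun _ => rfl, fun _ => rfl, fun _ => rfl, fun _ => rfl⟩
  | succ m ih =>
    rw [pow_succ]
    exact ih.comp h

lemma Intertwines.stable_ker {R : WeakRep v V} {S : WeakRep v W} {α : V →ₗ[F] W}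
    (h : R.Intertwines S α) : R.Stable (LinearMap.ker α) := by
  constructor <;> intro x hx <;> rw [LinearMap.mem_ker] at hx ⊢
  · rw [h.e, hx, map_zero]
  · rw [h.f, hx, map_zero]
  · rw [h.k, hx, map_zero]
  · rw [h.k', hx, map_zero]
  · rw [h.l, hx, map_zero]

lemma Intertwines.stable_range {R : WeakRep v V} {S : WeakRep v W} {α : V →ₗ[F] W}
    (h : R.Intertwines S α) : S.Stable (LinearMap.range α) := by
  constructor <;> rintro _ ⟨x, rfl⟩
  · exact ⟨_, h.e x⟩
  · exact ⟨_, h.f x⟩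
  · exact ⟨_, h.k x⟩
  · exact ⟨_, h.k' x⟩
  · exact ⟨_, h.l x⟩

lemma map_subtype_wt_restrict (R : WeakRep v V) {p : Submodule F V} (hp : R.Stable p) (c ε : F) :
    ((R.restrict hp).wt c ε).map p.subtype = R.wt c ε ⊓ p := by
  ext x
  simp only [Submodule.mem_map, Submodule.mem_inf, mem_wt, Subtype.exists]
  constructor
  · rintro ⟨y, hy, ⟨hk, hl⟩, rfl⟩
    exact ⟨⟨congrArg Subtype.val hk, congrArg Subtype.val hl⟩, hy⟩
  · rintro ⟨⟨hk, hl⟩, hx⟩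
    exact ⟨x, hx, ⟨Subtype.ext hk, Subtype.ext hl⟩, rfl⟩

lemma finrank_wt_restrict_add [FiniteDimensional F V] (R : WeakRep v V) {p q : Submodule F V}
    (hp : R.Stable p) (hq : R.Stable q) (hpq : IsCompl p q) (c ε : F) :
    finrank F ((R.restrict hp).wt c ε) + finrank F ((R.restrict hq).wt c ε) =
      finrank F (R.wt c ε) := by
  have hdisj : ∀ {a b : V}, a ∈ p → b ∈ q → a + b = 0 → a = 0 ∧ b = 0 := by
    intro a b ha hb hab
    have hab' : a = -b := eq_neg_of_add_eq_zero_left hab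
    have ha0 : a = 0 := Submodule.disjoint_def.1 hpq.disjoint a ha (hab' ▸ q.neg_mem hb)
    exact ⟨ha0, by rwa [ha0, zero_add] at hab⟩
  rw [← Submodule.finrank_map_subtype_eq p, ← Submodule.finrank_map_subtype_eq q,
    R.map_subtype_wt_restrict, R.map_subtype_wt_restrict, ← Submodule.finrank_sup_add_finrank_inf_eq]
  have hinf : R.wt c ε ⊓ p ⊓ (R.wt c ε ⊓ q) = ⊥ := by
    rw [inf_inf_inf_comm, hpq.inf_eq_bot, inf_bot_eq]
  have hsup : R.wt c ε ⊓ p ⊔ R.wt c ε ⊓ q = R.wt c ε := by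
    refine le_antisymm (sup_le inf_le_left inf_le_left) fun x hx => ?_
    obtain ⟨hk, hl⟩ := mem_wt.1 hx
    obtain ⟨a, ha, b, hb, rfl⟩ := Submodule.mem_sup.1 (hpq.sup_eq_top ▸ Submodule.mem_top (x := x))
    have hk' := hdisj (a := R.k a - c • a) (b := R.k b - c • b)
      (p.sub_mem (hp.k a ha) (p.smul_mem c ha)) (q.sub_mem (hq.k b hb) (q.smul_mem c hb))
      (by rw [← sub_eq_zero] at hk; rw [← hk, map_add]; module)
    have hl' := hdisj (a := R.l a - ε • a) (b := R.l b - ε • b)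
      (p.sub_mem (hp.l a ha) (p.smul_mem ε ha)) (q.sub_mem (hq.l b hb) (q.smul_mem ε hb))
      (by rw [← sub_eq_zero] at hl; rw [← hl, map_add]; module)
    exact Submodule.add_mem_sup
      ⟨mem_wt.2 ⟨sub_eq_zero.1 hk'.1, sub_eq_zero.1 hl'.1⟩, ha⟩
      ⟨mem_wt.2 ⟨sub_eq_zero.1 hk'.2, sub_eq_zero.1 hl'.2⟩, hb⟩
  rw [hinf, hsup, finrank_bot, add_zero]

lemma finrank_wt_eq {R : WeakRep v V} {S : WeakRep v W} (φ : V ≃ₗ[F] W)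
    (h : R.Intertwines S φ.toLinearMap) (c ε : F) :
    finrank F (R.wt c ε) = finrank F (S.wt c ε) := by
  have hmap : (R.wt c ε).map φ.toLinearMap = S.wt c ε := by
    ext x
    obtain ⟨y, rfl⟩ := φ.surjective x
    have hk := h.k y
    have hl := h.l y
    simp only [LinearEquiv.coe_coe] at hk hl
    simp only [Submodule.mem_map, LinearEquiv.coe_coe, EmbeddingLike.apply_eq_iff_eq,
      exists_eq_right, mem_wt, ← hk, ← hl, ← map_smul]
  rw [← hmap, LinearEquiv.finrank_map_eq]

lemma Intertwines.exists_sum {R : WeakRep v V} {S : WeakRep v W} {p q : Submodule F V}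
    {p' q' : Submodule F W} (hp : R.Stable p) (hq : R.Stable q) (hp' : S.Stable p')
    (hq' : S.Stable q') (hpq : IsCompl p q) (hpq' : IsCompl p' q') (φ : p ≃ₗ[F] p')
    (ψ : q ≃ₗ[F] q') (hφ : (R.restrict hp).Intertwines (S.restrict hp') φ.toLinearMap)
    (hψ : (R.restrict hq).Intertwines (S.restrict hq') ψ.toLinearMap) :
    ∃ χ : V ≃ₗ[F] W, R.Intertwines S χ.toLinearMap := by
  have key : ∀ (T : V →ₗ[F] V) (T' : W →ₗ[F] W) (hT : ∀ x ∈ p, T x ∈ p) (hT2 : ∀ x ∈ q, T x ∈ q)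
      (h1 : ∀ x : p, (φ ⟨T x, hT x x.2⟩ : W) = T' (φ x))
      (h2 : ∀ x : q, (ψ ⟨T x, hT2 x x.2⟩ : W) = T' (ψ x)) (z : V),
      ((p.prodEquivOfIsCompl q hpq).symm ≪≫ₗ φ.prodCongr ψ ≪≫ₗ p'.prodEquivOfIsCompl q' hpq')
        (T z) = T' (((p.prodEquivOfIsCompl q hpq).symm ≪≫ₗ φ.prodCongr ψ ≪≫ₗ
          p'.prodEquivOfIsCompl q' hpq') z) := by
    intro T T' hT hT2 h1 h2 z
    obtain ⟨⟨a, b⟩, rfl⟩ := (p.prodEquivOfIsCompl q hpq).surjective z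
    have : T (p.prodEquivOfIsCompl q hpq (a, b)) =
        p.prodEquivOfIsCompl q hpq (⟨T a, hT a a.2⟩, ⟨T b, hT2 b b.2⟩) := by
      simp
    rw [this]
    simp only [LinearEquiv.trans_apply, LinearEquiv.symm_apply_apply]
    simp only [LinearEquiv.prodCongr_apply, Submodule.coe_prodEquivOfIsCompl', map_add, h1, h2]
  exact ⟨_, key _ _ hp.e hq.e (fun x => congrArg Subtype.val (hφ.e x))
      fun x => congrArg Subtype.val (hψ.e x),
    key _ _ hp.f hq.f (fun x => congrArg Subtype.val (hφ.f x))
      fun x => congrArg Subtype.val (hψ.f x),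
    key _ _ hp.k hq.k (fun x => congrArg Subtype.val (hφ.k x))
      fun x => congrArg Subtype.val (hψ.k x),
    key _ _ hp.l hq.l (fun x => congrArg Subtype.val (hφ.l x))
      fun x => congrArg Subtype.val (hψ.l x)⟩

lemma map_comp_pow (α : V →ₗ[F] W) (β : W →ₗ[F] V) (m : ℕ) (x : V) :
    α (((β ∘ₗ α : Module.End F V) ^ m) x) = ((α ∘ₗ β : Module.End F W) ^ m) (α x) := by
  induction m with
  | zero => rfl
  | succ m ih =>
    rw [pow_succ', Module.End.mul_apply, pow_succ', Module.End.mul_apply, ← ih]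
    rfl

lemma map_mem_range_comp_pow (α : V →ₗ[F] W) (β : W →ₗ[F] V) (m : ℕ) :
    ∀ x ∈ LinearMap.range ((β ∘ₗ α : Module.End F V) ^ m),
      α x ∈ LinearMap.range ((α ∘ₗ β : Module.End F W) ^ m) := by
  rintro _ ⟨x, rfl⟩
  exact ⟨α x, (map_comp_pow α β m x).symm⟩

lemma restrict_range_comp_pow_injective (α : V →ₗ[F] W) (β : W →ₗ[F] V) {m : ℕ} (hm : 1 ≤ m)
    (h : IsCompl (LinearMap.ker ((β ∘ₗ α : Module.End F V) ^ m))
      (LinearMap.range ((β ∘ₗ α : Module.End F V) ^ m))) :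
    Function.Injective (α.restrict (map_mem_range_comp_pow α β m)) := by
  rw [injective_iff_map_eq_zero]
  rintro ⟨x, hx⟩ hx0
  have hαx : α x = 0 := congrArg Subtype.val hx0
  have hker : x ∈ LinearMap.ker ((β ∘ₗ α : Module.End F V) ^ m) := by
    obtain ⟨m, rfl⟩ := Nat.exists_eq_add_of_le' hm
    rw [LinearMap.mem_ker, pow_succ, Module.End.mul_apply, LinearMap.comp_apply, hαx, map_zero,
      map_zero]
  exact Subtype.ext (Submodule.disjoint_def.1 h.disjoint x hker hx)

/-- The Fitting decompositions of two representations along a pair of intertwiners. -/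
theorem Intertwines.exists_fitting [FiniteDimensional F V] [FiniteDimensional F W]
    {R : WeakRep v V} {S : WeakRep v W} {α : V →ₗ[F] W} {β : W →ₗ[F] V}
    (hα : R.Intertwines S α) (hβ : S.Intertwines R β) {x : V} (hx0 : x ≠ 0) (hx : β (α x) = x) :
    ∃ (p q : Submodule F V) (p' q' : Submodule F W) (_ : IsCompl p q) (_ : IsCompl p' q')
      (_ : R.Stable p) (hq : R.Stable q) (_ : S.Stable p') (hq' : S.Stable q') (_ : q ≠ ⊥)
      (ψ : q ≃ₗ[F] q'), (R.restrict hq).Intertwines (S.restrict hq') ψ.toLinearMap := by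
  obtain ⟨m, ⟨h1, h2⟩, hm⟩ := ((LinearMap.eventually_isCompl_ker_pow_range_pow (β ∘ₗ α)).and
    (LinearMap.eventually_isCompl_ker_pow_range_pow (α ∘ₗ β)) |>.and
      (Filter.eventually_ge_atTop 1)).exists
  have hφ := (hβ.comp hα).pow m
  have hψ := (hα.comp hβ).pow m
  have hinj := restrict_range_comp_pow_injective α β hm h1
  have hrank := le_antisymm (LinearMap.finrank_le_finrank_of_injective hinj)
    (LinearMap.finrank_le_finrank_of_injective (restrict_range_comp_pow_injective β α hm h2))
  refine ⟨_, _, _, _, h1, h2, hφ.stable_ker, hφ.stable_range, hψ.stable_ker, hψ.stable_range, ?_,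
    LinearMap.linearEquivOfInjective _ hinj hrank, ?_⟩
  · intro hbot
    have hxm : ((β ∘ₗ α : Module.End F V) ^ m) x = x := by
      clear hφ hψ h1 h2 hinj hrank hbot hm
      induction m with
      | zero => rfl
      | succ m ih => rw [pow_succ, Module.End.mul_apply, LinearMap.comp_apply, hx, ih]
    have : x ∈ LinearMap.range ((β ∘ₗ α : Module.End F V) ^ m) := ⟨x, hxm⟩
    rw [hbot, Submodule.mem_bot] at this
    exact hx0 this
  · exact ⟨fun y => Subtype.ext (hα.e y), fun y => Subtype.ext (hα.f y),
      fun y => Subtype.ext (hα.k y), fun y => Subtype.ext (hα.l y)⟩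

lemma SameWeights.subsingleton [FiniteDimensional F V] [FiniteDimensional F W] [Subsingleton V]
    (hv : Generic v) {R : WeakRep v V} {S : WeakRep v W} (h : R.SameWeights S) :
    Subsingleton W := by
  by_contra hW
  rw [not_subsingleton_iff_nontrivial] at hW
  obtain ⟨_, -, s, hs, a, -, ε, hε, hw⟩ := S.exists_bounded hv
  exact hw (h.wt_eq_bot hs hε (Subsingleton.elim _ _))

end

/-- Finite dimensional representations with the same weights are isomorphic. -/
theorem SameWeights.exists_equiv (hv : Generic v) {V W : Type*} [AddCommGroup V] [Module F V]
    [AddCommGroup W] [Module F W] [FiniteDimensional F V] [FiniteDimensional F W]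
    {R : WeakRep v V} {S : WeakRep v W} (hR : R.Serre) (hS : S.Serre) (h : R.SameWeights S) :
    ∃ χ : V ≃ₗ[F] W, R.Intertwines S χ.toLinearMap := by
  induction hn : finrank F V using Nat.strong_induction_on generalizing V W with
  | _ n ih =>
    rcases subsingleton_or_nontrivial V with hV | hV
    · have hW := h.subsingleton hv
      exact ⟨0, fun _ => Subsingleton.elim _ _, fun _ => Subsingleton.elim _ _,
        fun _ => Subsingleton.elim _ _, fun _ => Subsingleton.elim _ _⟩
    · obtain ⟨α, β, x, hα, hβ, hx0, hx⟩ := h.exists_intertwines hv hR hS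
      obtain ⟨p, q, p', q', hpq, hpq', hp, hq, hp', hq', hq0, ψ, hψ⟩ :=
        hα.exists_fitting hβ hx0 hx
      have hlt : finrank F p < n := by
        rw [← hn, ← Submodule.finrank_add_eq_of_isCompl hpq]
        exact Nat.lt_add_of_pos_right
          (Nat.pos_of_ne_zero fun h0 => hq0 (Submodule.finrank_eq_zero.1 h0))
      have hsame : (R.restrict hp).SameWeights (S.restrict hp') := by
        intro s hs a ε hε
        have h1 := h s hs a ε hε
        rw [← R.finrank_wt_restrict_add hp hq hpq, ← S.finrank_wt_restrict_add hp' hq' hpq',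
          finrank_wt_eq ψ hψ] at h1
        exact Nat.add_right_cancel h1
      obtain ⟨φ, hφ⟩ := ih _ hlt (hR.restrict hp) (hS.restrict hp') hsame rfl
      exact Intertwines.exists_sum hp hq hp' hq' hpq hpq' φ ψ hφ hψ

end Isomorphism

end WeakRep

end Representations

lemma generic_vv : Generic vv where
  ne_zero := RatFunc.X_ne_zero
  pow_ne_one n hn h := by
    have hX : (Polynomial.X : Polynomial ℂ) ^ n = 1 := by
      apply RatFunc.algebraMap_injective ℂ
      rw [map_pow, map_one, RatFunc.algebraMap_X]
      exact h
    have := congrArg Polynomial.natDegree hX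
    rw [Polynomial.natDegree_X_pow, Polynomial.natDegree_one] at this
    omega
  two_ne_zero := two_ne_zero

section

variable {V : Type} [AddCommGroup V] [Module K V] (ρ : MU2 →ₐ[K] Module.End K V)

lemma apply_eq_of_rel {a b : FreeAlgebra K G5} (h : Rel a b) (x : V) :
    ρ (RingQuot.mkAlgHom K Rel a) x = ρ (RingQuot.mkAlgHom K Rel b) x := by
  rw [RingQuot.mkAlgHom_rel K h]

/-- The operators by which the generators of `MU_v(2)` act on a representation. -/
def toWeakRep : WeakRep vv V where
  e := ρ Ee
  f := ρ Ff
  k := ρ Kk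
  k' := ρ Kk'
  l := ρ Ll
  kk' x := by simpa [Kk, Kk'] using apply_eq_of_rel ρ Rel.kk' x
  k'k x := by simpa [Kk, Kk'] using apply_eq_of_rel ρ Rel.k'k x
  ke x := by
    have h1 : ρ Kk' (ρ Kk x) = x := by simpa [Kk, Kk'] using apply_eq_of_rel ρ Rel.k'k x
    have h2 : ρ Kk (ρ Ee (ρ Kk' (ρ Kk x))) = vv ^ 2 • ρ Ee (ρ Kk x) := by
      simpa [Kk, Kk', Ee] using apply_eq_of_rel ρ Rel.kek' (ρ Kk x)
    rwa [h1] at h2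
  fk x := by
    have h1 : ρ Kk' (ρ Kk x) = x := by simpa [Kk, Kk'] using apply_eq_of_rel ρ Rel.k'k x
    have h2 : ρ Kk (ρ Ff (ρ Kk' (ρ Kk x))) = vv ^ (-2 : ℤ) • ρ Ff (ρ Kk x) := by
      simpa [Kk, Kk', Ff] using apply_eq_of_rel ρ Rel.kfk' (ρ Kk x)
    rw [h1] at h2
    rw [h2, smul_smul, ← zpow_natCast, ← zpow_add₀ generic_vv.ne_zero]
    simp
  ef x := by
    have h : ρ Ee (ρ Ff x) - ρ Ff (ρ Ee x) = (vv - vv⁻¹)⁻¹ • (ρ Kk x - ρ Kk' x) := by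
      simpa [Ee, Ff, Kk, Kk'] using apply_eq_of_rel ρ Rel.effe x
    rw [← h, add_sub_cancel]
  ll x := by simpa [Ll] using apply_eq_of_rel ρ Rel.ll x
  kl x := by simpa [Kk, Ll] using apply_eq_of_rel ρ Rel.kl x
  lel x := by simpa [Ll, Ee] using apply_eq_of_rel ρ Rel.lel x
  lfl x := by simpa [Ll, Ff] using apply_eq_of_rel ρ Rel.lfl x

lemma serre_toWeakRep : (toWeakRep ρ).Serre where
  serreE x := by simpa [toWeakRep, Ee, Ll] using apply_eq_of_rel ρ Rel.serreE x
  serreF x := by simpa [toWeakRep, Ff, Ll] using apply_eq_of_rel ρ Rel.serreF x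

variable {ρ} {W : Type} [AddCommGroup W] [Module K W] {τ : MU2 →ₐ[K] Module.End K W}

lemma repIso_of_intertwines (φ : V ≃ₗ[K] W)
    (h : (toWeakRep ρ).Intertwines (toWeakRep τ) φ.toLinearMap) : RepIso ρ τ := by
  refine ⟨φ, fun a => ?_⟩
  obtain ⟨a, rfl⟩ := RingQuot.mkAlgHom_surjective K Rel a
  induction a using FreeAlgebra.induction with
  | grade0 r => simp
  | grade1 g =>
    cases g with
    | e => exact h.e
    | f => exact h.f
    | k => exact h.k
    | k' => exact h.k'
    | l => exact h.l
  | mul a b ha hb => simp [ha, hb]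
  | add a b ha hb => simp [ha, hb]

end

/-- Corollary 5.13: two finite dimensional `MU_v(2)`-modules with the same weight
space dimensions (for all weights `(±v^a, ε)`, `a ∈ ℤ`, `ε ∈ {0,1}`) are isomorphic. -/
theorem iso_of_same_weights
    (M : Type) [AddCommGroup M] [Module K M] [FiniteDimensional K M]
    (N : Type) [AddCommGroup N] [Module K N] [FiniteDimensional K N]
    (ρ : MU2 →ₐ[K] Module.End K M) (τ : MU2 →ₐ[K] Module.End K N)
    (h : ∀ lam eps : K, (∃ a : ℤ, lam = vv ^ a ∨ lam = -vv ^ a) →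
      (eps = 0 ∨ eps = 1) →
      Module.finrank K (wtSpace ρ lam eps) = Module.finrank K (wtSpace τ lam eps)) :
    RepIso ρ τ := by
  refine (WeakRep.SameWeights.exists_equiv generic_vv (serre_toWeakRep ρ) (serre_toWeakRep τ)
    fun s hs a ε hε => h _ ε ⟨a, ?_⟩ hε).elim repIso_of_intertwines
  rcases hs with rfl | rfl
  · exact Or.inl (one_mul _)
  · exact Or.inr (neg_one_mul _)

end

end MirabolicSL2
end
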